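/- arXiv:0911.3633 — 5 statements merged into one kernel-verified Lean document; each statement's English description precedes it below -/
import Mathlib

section
/- If a d-maximum class C ⊆ {0,1}^n can be corner-peeled via an ordering v_1,…,v_{|C|}, then the map r sending each v_t to the set of colors of the edges incident to v_t in the one-inclusion graph of C_{t−1} is a bijection between C and the collection of all subsets of {1,…,n} of cardinality at most d, and r is non-clashing; hence C admits an unlabeled compression scheme of size d. -/
open Finset

namespace GeomCompress

/-- `C` shatters the coordinate set `Y`: every pattern on `Y` is realized by some concept. -/
def Shatters {n : ℕ} (C : Finset (Fin n → Bool)) (Y : Finset (Fin n)) : Prop :=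
  ∀ p : Fin n → Bool, ∃ c ∈ C, ∀ i ∈ Y, c i = p i

/-- The VC dimension of `C` equals `d`. -/
def VCDimEq {n : ℕ} (C : Finset (Fin n → Bool)) (d : ℕ) : Prop :=
  (∃ Y : Finset (Fin n), Y.card = d ∧ Shatters C Y) ∧
    ∀ Y : Finset (Fin n), Shatters C Y → Y.card ≤ d

/-- `C` is a `d`-maximum class: VC dimension `d` and maximum possible cardinality. -/
def IsMaximum {n : ℕ} (C : Finset (Fin n → Bool)) (d : ℕ) : Prop :=
  VCDimEq C d ∧ C.card = ∑ i ∈ Finset.range (d + 1), Nat.choose n i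

/-- Hamming distance between two Boolean vectors. -/
def hamming {n : ℕ} (u v : Fin n → Bool) : ℕ :=
  (Finset.univ.filter fun i => u i ≠ v i).card

/-- Adjacency in the one-inclusion graph: differ in exactly one coordinate. -/
def Adj {n : ℕ} (u v : Fin n → Bool) : Prop := hamming u v = 1

instance {n : ℕ} (u v : Fin n → Bool) : Decidable (Adj u v) := by
  unfold Adj; infer_instance

/-- `Q` is a cube of `C` colored by `I`: a subset of `C` whose elements agree outside `I`
and realize all patterns on `I`. -/
def IsCube {n : ℕ} (C Q : Finset (Fin n → Bool)) (I : Finset (Fin n)) : Prop :=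
  Q ⊆ C ∧ (∀ u ∈ Q, ∀ v ∈ Q, ∀ i, i ∉ I → u i = v i) ∧
    ∀ p : Fin n → Bool, ∃ u ∈ Q, ∀ i ∈ I, u i = p i

/-- `v` is a corner vertex of `C`: there is a unique cube of maximum dimension among all
cubes of `C` containing `v`, and all neighbors of `v` in the one-inclusion graph of `C`
lie in that cube. -/
def IsCorner {n : ℕ} (C : Finset (Fin n → Bool)) (v : Fin n → Bool) : Prop :=
  ∃ Q I, IsCube C Q I ∧ v ∈ Q ∧
    (∀ Q' I', IsCube C Q' I' → v ∈ Q' → I'.card ≤ I.card) ∧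
    (∀ Q' I', IsCube C Q' I' → v ∈ Q' → I'.card = I.card → Q' = Q) ∧
    ∀ u ∈ C, Adj u v → u ∈ Q

/-- The class remaining after peeling the first `t` vertices of the ordering `v`. -/
def Peeled {n m : ℕ} (C : Finset (Fin n → Bool)) (v : Fin m → (Fin n → Bool)) (t : Fin m) :
    Finset (Fin n → Bool) :=
  C \ (Finset.univ.filter fun s : Fin m => s < t).image v

/-- `v` is a corner-peeling ordering of `C`: an enumeration of `C` such that each `v t`
is a corner vertex of the class remaining before step `t`. -/
def IsCornerPeeling {n : ℕ} (C : Finset (Fin n → Bool)) (v : Fin C.card → (Fin n → Bool)) :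
    Prop :=
  Function.Injective v ∧ (∀ t, v t ∈ C) ∧ ∀ t, IsCorner (Peeled C v t) (v t)

/-- Degree of `v` in the one-inclusion graph of `C`. -/
def degreeIn {n : ℕ} (C : Finset (Fin n → Bool)) (v : Fin n → Bool) : ℕ :=
  (C.filter fun u => Adj u v).card

/-- The colors of the edges incident to `v` in the one-inclusion graph of `C`. -/
def incidentColors {n : ℕ} (C : Finset (Fin n → Bool)) (v : Fin n → Bool) : Finset (Fin n) :=
  Finset.univ.filter fun i => ∃ u ∈ C, Adj u v ∧ u i ≠ v i

/-- `C` is shortest-path closed: any two concepts are joined in the one-inclusion graph of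
`C` by a path whose length is their Hamming distance. -/
def SPClosed {n : ℕ} (C : Finset (Fin n → Bool)) : Prop :=
  ∀ u ∈ C, ∀ v ∈ C, ∃ p : ℕ → (Fin n → Bool),
    p 0 = u ∧ p (hamming u v) = v ∧ (∀ k ≤ hamming u v, p k ∈ C) ∧
    ∀ k < hamming u v, Adj (p k) (p (k + 1))

/-- `Q` (colored by `I`, with `I.card = d - 1`) is a cube of the boundary `∂C` of the
`d`-maximum class `C`: it is a face of exactly one `d`-cube of `C`. -/
def IsBoundaryCube {n : ℕ} (C : Finset (Fin n → Bool)) (d : ℕ)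
    (Q : Finset (Fin n → Bool)) (I : Finset (Fin n)) : Prop :=
  IsCube C Q I ∧ I.card = d - 1 ∧
    (∃ Q' I', IsCube C Q' I' ∧ I'.card = d ∧ Q ⊆ Q' ∧ I ⊆ I') ∧
    ∀ Q₁ I₁ Q₂ I₂, IsCube C Q₁ I₁ → I₁.card = d → Q ⊆ Q₁ → I ⊆ I₁ →
      IsCube C Q₂ I₂ → I₂.card = d → Q ⊆ Q₂ → I ⊆ I₂ → Q₁ = Q₂

/-- Standard inner product on `Fin d → ℝ`. -/
def dotR {d : ℕ} (x y : Fin d → ℝ) : ℝ := ∑ i, x i * y i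

/-- `x` lies on none of the hyperplanes `⟪a i, ·⟫ = b i`. -/
def OnNoHyperplane {d N : ℕ} (a : Fin N → Fin d → ℝ) (b : Fin N → ℝ) (x : Fin d → ℝ) :
    Prop :=
  ∀ i, dotR (a i) x ≠ b i

/-- The sign vector of the point `x` with respect to the oriented hyperplanes `(a, b)`. -/
noncomputable def signVec {d N : ℕ} (a : Fin N → Fin d → ℝ) (b : Fin N → ℝ)
    (x : Fin d → ℝ) : Fin N → Bool :=
  fun i => decide (b i < dotR (a i) x)

/-- `C` is the concept class induced by the arrangement `(a, b)`: the set of sign vectors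
of points lying on none of the hyperplanes. -/
def IsInducedClass {d N : ℕ} (a : Fin N → Fin d → ℝ) (b : Fin N → ℝ)
    (C : Finset (Fin N → Bool)) : Prop :=
  ∀ c, c ∈ C ↔ ∃ x : Fin d → ℝ, OnNoHyperplane a b x ∧ signVec a b x = c

/-- A simple linear arrangement in `ℝ^d`: every `≤ d` of the hyperplanes are in general
position (normals linearly independent, so every `k ≤ d` of them intersect in an affine
subspace of dimension `d - k`), and every `d+1` of them have empty common intersection. -/
def SimpleArrangement (d : ℕ) {N : ℕ} (a : Fin N → Fin d → ℝ) (b : Fin N → ℝ) : Prop :=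
  (∀ S : Finset (Fin N), S.card ≤ d → LinearIndependent ℝ (fun i : S => a i.1)) ∧
    ∀ S : Finset (Fin N), S.card = d + 1 → ¬∃ x : Fin d → ℝ, ∀ i ∈ S, dotR (a i) x = b i

/-- Membership in the open unit ball (Klein model of hyperbolic space `H^k`). -/
def inBall {k : ℕ} (x : Fin k → ℝ) : Prop := ∑ i, x i ^ 2 < 1

/-- A simple hyperbolic `d`-arrangement in the Klein model `H^k`: every `d` of the
hyperplanes intersect inside the unit ball in a `(k-d)`-dimensional hyperbolic plane
(normals independent and common point inside the ball), and every `d+1` of them have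
empty common intersection inside the ball. -/
def SimpleHyperbolicArrangement (d : ℕ) {k N : ℕ} (a : Fin N → Fin k → ℝ)
    (b : Fin N → ℝ) : Prop :=
  (∀ S : Finset (Fin N), S.card = d →
      LinearIndependent ℝ (fun i : S => a i.1) ∧
        ∃ x : Fin k → ℝ, inBall x ∧ ∀ i ∈ S, dotR (a i) x = b i) ∧
    ∀ S : Finset (Fin N), S.card = d + 1 →
      ¬∃ x : Fin k → ℝ, inBall x ∧ ∀ i ∈ S, dotR (a i) x = b i

/-- The concept class induced by a hyperbolic arrangement: sign vectors of points of the
open unit ball lying on none of the hyperplanes. -/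
def IsInducedClassH {k N : ℕ} (a : Fin N → Fin k → ℝ) (b : Fin N → ℝ)
    (C : Finset (Fin N → Bool)) : Prop :=
  ∀ c, c ∈ C ↔ ∃ x : Fin k → ℝ, inBall x ∧ OnNoHyperplane a b x ∧ signVec a b x = c

/-- A generic arrangement of oriented affine hyperplanes in `ℝ^n`: every subcollection of
`k` hyperplanes, `2 ≤ k ≤ n`, either has empty common intersection or intersects
transversely (normals linearly independent, giving an affine subspace of dim `n - k`). -/
def GenericArrangement {n N : ℕ} (a : Fin N → Fin n → ℝ) (b : Fin N → ℝ) : Prop :=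
  ∀ S : Finset (Fin N), 2 ≤ S.card → S.card ≤ n →
    (¬∃ x : Fin n → ℝ, ∀ i ∈ S, dotR (a i) x = b i) ∨
      LinearIndependent ℝ (fun i : S => a i.1)

/-- `C` is a maximal class of VC dimension `d`: adding any new concept increases the VC
dimension. -/
def IsMaximalClass {n : ℕ} (C : Finset (Fin n → Bool)) (d : ℕ) : Prop :=
  VCDimEq C d ∧
    ∀ c : Fin n → Bool, c ∉ C →
      ∃ Y : Finset (Fin n), d < Y.card ∧ Shatters (insert c C) Y

/-- A path in the one-inclusion graph of `C` avoiding `C'`, from a vertex of `Q1` to a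
vertex of `Q2`. -/
def CConnPath {n : ℕ} (C C' Q1 Q2 : Finset (Fin n → Bool)) : Prop :=
  ∃ (L : ℕ) (p : ℕ → Fin n → Bool),
    p 0 ∈ Q1 ∧ p L ∈ Q2 ∧ (∀ j ≤ L, p j ∈ C ∧ p j ∉ C') ∧
      ∀ j < L, Adj (p j) (p (j + 1))

/-- `Q1` and `Q2` are `d`-cubes of `C` joined by a path of the one-inclusion graph of `C`
avoiding `C'`. -/
def CComponentRel {n : ℕ} (C C' : Finset (Fin n → Bool)) (d : ℕ)
    (Q1 Q2 : Finset (Fin n → Bool)) : Prop :=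
  (∃ I, IsCube C Q1 I ∧ I.card = d) ∧ (∃ I, IsCube C Q2 I ∧ I.card = d) ∧
    CConnPath C C' Q1 Q2

/-- `Comp` enumerates the `C'`-connected components of `C`: each component is a union of
`d`-cubes of `C`, every `d`-cube lies in exactly one component, and two `d`-cubes lie in
the same component iff they are related under the transitive closure of
`C'`-connectedness. -/
def IsComponents {n : ℕ} (C C' : Finset (Fin n → Bool)) (d : ℕ) {k : ℕ}
    (Comp : Fin k → Finset (Fin n → Bool)) : Prop :=
  (∀ q, ∀ x ∈ Comp q, ∃ Q I, IsCube C Q I ∧ I.card = d ∧ x ∈ Q ∧ Q ⊆ Comp q) ∧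
  (∀ Q I, IsCube C Q I → I.card = d → ∃ q, Q ⊆ Comp q) ∧
  (∀ q q' Q I, IsCube C Q I → I.card = d → Q ⊆ Comp q → Q ⊆ Comp q' → q = q') ∧
  ∀ q Q1 I1, IsCube C Q1 I1 → I1.card = d → Q1 ⊆ Comp q →
    ∀ Q2 I2, IsCube C Q2 I2 → I2.card = d →
      (Q2 ⊆ Comp q ↔ Relation.TransGen (CComponentRel C C' d) Q1 Q2)

/-- Append the bit `b` as a new last coordinate. -/
def app {n : ℕ} (c : Fin n → Bool) (b : Bool) : Fin (n + 1) → Bool := Fin.snoc c b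

/-- The lift `(C' × {0,1}) ∪ ⋃_q (Comp q × {p q})`. -/
def LiftClass {n k : ℕ} (C' : Finset (Fin n → Bool))
    (Comp : Fin k → Finset (Fin n → Bool)) (p : Fin k → Bool) :
    Finset (Fin (n + 1) → Bool) :=
  C'.image (fun c => app c false) ∪ C'.image (fun c => app c true) ∪
    Finset.univ.biUnion fun q => (Comp q).image fun c => app c (p q)

/-- The vector obtained from `u` by flipping the bit `i`. -/
def flip {n : ℕ} (u : Fin n → Bool) (i : Fin n) : Fin n → Bool :=
  Function.update u i (!u i)

theorem flip_apply_self {n : ℕ} (u : Fin n → Bool) (i : Fin n) : flip u i i = !u i := by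
  simp [flip]

theorem flip_apply_of_ne {n : ℕ} (u : Fin n → Bool) {i j : Fin n} (h : j ≠ i) :
    flip u i j = u j := by
  simp [flip, h]

theorem flip_flip {n : ℕ} (u : Fin n → Bool) (i : Fin n) : flip (flip u i) i = u := by
  simp [flip]

theorem eq_flip_of_forall_ne {n : ℕ} {u v : Fin n → Bool} {i : Fin n} (hi : u i ≠ v i)
    (h : ∀ j, j ≠ i → u j = v j) : u = flip v i := by
  funext j
  by_cases hj : j = i
  · subst hj
    rw [flip_apply_self]
    exact Bool.eq_not.mpr hi
  · rw [flip_apply_of_ne _ hj, h j hj]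

theorem adj_flip {n : ℕ} (v : Fin n → Bool) (i : Fin n) : Adj (flip v i) v := by
  unfold Adj hamming
  rw [card_eq_one]
  refine ⟨i, ?_⟩
  ext j
  by_cases hj : j = i
  · subst hj
    simp [flip_apply_self]
  · simp [flip_apply_of_ne _ hj, hj]

theorem eq_flip_of_adj {n : ℕ} {u v : Fin n → Bool} {i : Fin n} (h : Adj u v)
    (hi : u i ≠ v i) : u = flip v i := by
  unfold Adj hamming at h
  obtain ⟨k, hk⟩ := card_eq_one.mp h
  have hmem : ∀ j, u j ≠ v j ↔ j = k := fun j => by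
    simpa using congrArg (j ∈ ·) hk
  have hik := (hmem i).mp hi
  subst hik
  exact eq_flip_of_forall_ne hi fun j hj => by
    by_contra hne
    exact hj ((hmem j).mp hne)

theorem mem_incidentColors {n : ℕ} {C : Finset (Fin n → Bool)} {v : Fin n → Bool}
    {i : Fin n} : i ∈ incidentColors C v ↔ flip v i ∈ C := by
  simp only [incidentColors, mem_filter, mem_univ, true_and]
  constructor
  · rintro ⟨u, hu, hadj, hi⟩
    rwa [← eq_flip_of_adj hadj hi]
  · intro h
    exact ⟨_, h, adj_flip v i, by simp [flip_apply_self]⟩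

theorem IsCube.mem_of_agree {n : ℕ} {C Q : Finset (Fin n → Bool)} {I : Finset (Fin n)}
    (h : IsCube C Q I) {v x : Fin n → Bool} (hv : v ∈ Q) (hx : ∀ i, i ∉ I → x i = v i) :
    x ∈ Q := by
  obtain ⟨u, hu, hux⟩ := h.2.2 x
  have : u = x := by
    funext i
    by_cases hi : i ∈ I
    · exact hux i hi
    · rw [hx i hi, h.2.1 u hu v hv i hi]
  rwa [← this]

theorem IsCube.shatters {n : ℕ} {C Q : Finset (Fin n → Bool)} {I : Finset (Fin n)}
    (h : IsCube C Q I) : Shatters C I := fun p => by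
  obtain ⟨u, hu, hup⟩ := h.2.2 p
  exact ⟨u, h.1 hu, hup⟩

theorem Shatters.mono {n : ℕ} {C D : Finset (Fin n → Bool)} {Y : Finset (Fin n)}
    (h : Shatters C Y) (hCD : C ⊆ D) : Shatters D Y := fun p => by
  obtain ⟨c, hc, hcp⟩ := h p
  exact ⟨c, hCD hc, hcp⟩

/-- A corner vertex lies in a cube colored by its incident colors. -/
theorem IsCorner.exists_isCube {n : ℕ} {C : Finset (Fin n → Bool)} {v : Fin n → Bool}
    (h : IsCorner C v) : ∃ Q, IsCube C Q (incidentColors C v) ∧ v ∈ Q := by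
  obtain ⟨Q, I, hQ, hv, -, -, hnb⟩ := h
  have hI : incidentColors C v = I := by
    ext i
    rw [mem_incidentColors]
    constructor
    · intro hi
      by_contra hiI
      have := hQ.2.1 _ (hnb _ hi (adj_flip v i)) v hv i hiI
      simp [flip_apply_self] at this
    · intro hi
      exact hQ.1 (hQ.mem_of_agree hv fun j hj =>
        flip_apply_of_ne _ fun hji => hj (hji ▸ hi))
  exact ⟨Q, hI ▸ hQ, hv⟩

/-- From every concept one can step inside `C` towards any other concept of `C`. -/
def Isometric {n : ℕ} (C : Finset (Fin n → Bool)) : Prop :=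
  ∀ u ∈ C, ∀ w ∈ C, u ≠ w → ∃ i, u i ≠ w i ∧ flip u i ∈ C

theorem Isometric.erase_corner {n : ℕ} {C : Finset (Fin n → Bool)} {v : Fin n → Bool}
    (hC : Isometric C) (hv : IsCorner C v) : Isometric (C.erase v) := by
  intro u hu w hw huw
  rw [mem_erase] at hu hw
  obtain ⟨i, hi, hiC⟩ := hC u hu.2 w hw.2 huw
  by_cases hiv : flip u i = v
  · obtain ⟨Q, hQ, hvQ⟩ := hv.exists_isCube
    obtain ⟨j, hj, hjC⟩ := hC v (hiv ▸ hiC) w hw.2 hw.1.symm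
    have hij : j ≠ i := by
      rintro rfl
      rw [← hiv, flip_apply_self] at hj
      exact hj (Bool.eq_not.mpr hi.symm).symm
    have huj : u j = v j := by rw [← hiv, flip_apply_of_ne _ hij]
    have hui : flip v i = u := by rw [← hiv, flip_flip]
    refine ⟨j, huj ▸ hj, mem_erase.mpr ⟨?_, ?_⟩⟩
    · intro h
      have := congrFun h j
      rw [flip_apply_self, huj] at this
      simp at this
    · refine hQ.1 (hQ.mem_of_agree hvQ fun k hk => ?_)
      have hki : k ≠ i := by
        rintro rfl
        exact hk (mem_incidentColors.mpr (hui ▸ hu.2))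
      have hkj : k ≠ j := by
        rintro rfl
        exact hk (mem_incidentColors.mpr hjC)
      rw [flip_apply_of_ne _ hkj, ← hui, flip_apply_of_ne _ hki]
  · exact ⟨i, hi, mem_erase.mpr ⟨hiv, hiC⟩⟩

open Classical in
/-- The family of coordinate sets shattered by `C`. -/
noncomputable def shatteredSets {n : ℕ} (C : Finset (Fin n → Bool)) :
    Finset (Finset (Fin n)) :=
  univ.filter (Shatters C)

theorem mem_shatteredSets {n : ℕ} {C : Finset (Fin n → Bool)} {Y : Finset (Fin n)} :
    Y ∈ shatteredSets C ↔ Shatters C Y := by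
  simp [shatteredSets]

theorem Shatters.notMem_of_section {n : ℕ} {C : Finset (Fin n → Bool)} {Y : Finset (Fin n)}
    {i : Fin n} {b : Bool} (h : Shatters (C.filter fun c => c i = b) Y) : i ∉ Y := by
  intro hi
  obtain ⟨c, hc, hcp⟩ := h fun _ => !b
  have := hcp i hi
  rw [(mem_filter.mp hc).2] at this
  simp at this

theorem Shatters.insert_of_sections {n : ℕ} {C : Finset (Fin n → Bool)}
    {Y : Finset (Fin n)} {i : Fin n} (h : ∀ b, Shatters (C.filter fun c => c i = b) Y) :
    Shatters C (insert i Y) := by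
  intro p
  obtain ⟨c, hc, hcp⟩ := h (p i) p
  rw [mem_filter] at hc
  refine ⟨c, hc.1, fun j hj => ?_⟩
  rcases mem_insert.mp hj with rfl | hj
  · exact hc.2
  · exact hcp j hj

theorem card_shatteredSets_sections_le {n : ℕ} (C : Finset (Fin n → Bool)) (i : Fin n)
    (b : Bool) :
    (shatteredSets (C.filter fun c => c i = b)).card +
      (shatteredSets (C.filter fun c => c i = !b)).card ≤ (shatteredSets C).card := by
  set A := shatteredSets (C.filter fun c => c i = b) with hA
  set B := shatteredSets (C.filter fun c => c i = !b) with hB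
  have hiA : ∀ Y ∈ A, i ∉ Y := fun Y hY => (mem_shatteredSets.mp hY).notMem_of_section
  have hiB : ∀ Y ∈ B, i ∉ Y := fun Y hY => (mem_shatteredSets.mp hY).notMem_of_section
  have hinj : Set.InjOn (insert i) ((A ∩ B : Finset (Finset (Fin n))) : Set (Finset (Fin n))) := by
    intro Y hY Z hZ hYZ
    have hY' := hiA Y (mem_inter.mp hY).1
    have hZ' := hiA Z (mem_inter.mp hZ).1
    rw [← erase_insert hY', ← erase_insert hZ']
    exact congrArg (fun X => erase X i) hYZ
  have hdisj : Disjoint (A ∪ B) ((A ∩ B).image (insert i)) := by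
    rw [disjoint_left]
    intro Y hY hY'
    obtain ⟨Z, -, rfl⟩ := mem_image.mp hY'
    rcases mem_union.mp hY with h | h
    · exact hiA _ h (mem_insert_self i Z)
    · exact hiB _ h (mem_insert_self i Z)
  rw [← card_union_add_card_inter, ← card_image_of_injOn hinj, ← card_union_of_disjoint hdisj]
  refine card_le_card fun Y hY => mem_shatteredSets.mpr ?_
  rcases mem_union.mp hY with h | h
  · rcases mem_union.mp h with h | h
    · exact (mem_shatteredSets.mp h).mono (filter_subset _ _)
    · exact (mem_shatteredSets.mp h).mono (filter_subset _ _)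
  · obtain ⟨Z, hZ, rfl⟩ := mem_image.mp h
    rw [mem_inter] at hZ
    refine Shatters.insert_of_sections fun b' => ?_
    by_cases hb : b' = b
    · rw [hb]
      exact mem_shatteredSets.mp hZ.1
    · rw [Bool.eq_not.mpr hb]
      exact mem_shatteredSets.mp hZ.2

theorem card_sections {n : ℕ} (C : Finset (Fin n → Bool)) (i : Fin n) (b : Bool) :
    (C.filter fun c => c i = b).card + (C.filter fun c => c i = !b).card = C.card := by
  rw [← card_filter_add_card_filter_not (s := C) fun c => c i = b]
  congr 2
  ext c
  simp [Bool.eq_not]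

/-- Pajor's inequality: a class shatters at least as many sets as it has concepts. -/
theorem card_le_card_shatteredSets {n : ℕ} (C : Finset (Fin n → Bool)) :
    C.card ≤ (shatteredSets C).card := by
  induction C using Finset.strongInduction with
  | H C ih =>
    by_cases hC : C.card ≤ 1
    · rcases C.eq_empty_or_nonempty with rfl | ⟨c, hc⟩
      · simp
      · refine hC.trans (card_pos.mpr ⟨∅, mem_shatteredSets.mpr fun p => ⟨c, hc, ?_⟩⟩)
        simp
    · obtain ⟨u, hu, w, hw, huw⟩ := one_lt_card.mp (not_le.mp hC)
      obtain ⟨i, hi⟩ := Function.ne_iff.mp huw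
      have h1 := ih (C.filter fun c => c i = u i)
        (filter_ssubset.mpr ⟨w, hw, fun h => hi h.symm⟩)
      have h2 := ih (C.filter fun c => c i = !u i)
        (filter_ssubset.mpr ⟨u, hu, by simp⟩)
      have h3 := card_shatteredSets_sections_le C i (u i)
      have h4 := card_sections C i (u i)
      omega

/-- `C` is shattering-extremal: it attains equality in Pajor's inequality. -/
def IsExtremal {n : ℕ} (C : Finset (Fin n → Bool)) : Prop :=
  (shatteredSets C).card ≤ C.card

theorem IsExtremal.halfcube {n : ℕ} {C : Finset (Fin n → Bool)} (hC : IsExtremal C)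
    (i : Fin n) (b : Bool) : IsExtremal (C.filter fun c => c i = b) := by
  have h1 := card_le_card_shatteredSets (C.filter fun c => c i = !b)
  have h2 := card_shatteredSets_sections_le C i b
  have h3 := card_sections C i b
  unfold IsExtremal at *
  omega

theorem IsExtremal.subcube {n : ℕ} {C : Finset (Fin n → Bool)} (hC : IsExtremal C)
    (u : Fin n → Bool) (S : Finset (Fin n)) :
    IsExtremal (C.filter fun c => ∀ i ∈ S, c i = u i) := by
  induction S using Finset.induction_on with
  | empty => simpa using hC
  | insert i S _ ih =>
    convert ih.halfcube i (u i) using 1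
    ext c
    simp only [mem_filter, mem_insert, forall_eq_or_imp]
    tauto

theorem hamming_eq_zero {n : ℕ} {u w : Fin n → Bool} : hamming u w = 0 ↔ u = w := by
  simp [hamming, filter_eq_empty_iff, funext_iff]

theorem IsExtremal.isometric {n : ℕ} {C : Finset (Fin n → Bool)} (hC : IsExtremal C) :
    Isometric C := by
  intro u hu w hw huw
  induction hk : hamming u w using Nat.strong_induction_on generalizing w with
  | _ k ih =>
    subst hk
    by_cases hx : ∃ x ∈ C, x ≠ u ∧ x ≠ w ∧ ∀ i, u i = w i → x i = u i
    · obtain ⟨x, hxC, hxu, hxw, hx⟩ := hx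
      have hlt : hamming u x < hamming u w := by
        obtain ⟨i, hi⟩ := Function.ne_iff.mp hxw
        refine card_lt_card ((ssubset_iff_of_subset fun j hj => ?_).mpr ⟨i, ?_, ?_⟩)
        · simp only [mem_filter, mem_univ, true_and] at hj ⊢
          exact fun h => hj (hx j h).symm
        · simp only [mem_filter, mem_univ, true_and]
          exact fun h => hi ((hx i h).trans h)
        · simp only [mem_filter, mem_univ, true_and, not_not]
          by_contra hne
          have hwu : u i ≠ w i := fun h => hi ((hx i h).trans h)
          exact hi ((Bool.eq_not.mpr (Ne.symm hne)).trans (Bool.eq_not.mpr hwu.symm).symm)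
      obtain ⟨i, hi, hiC⟩ := ih _ hlt x hxC hxu.symm rfl
      exact ⟨i, fun h => hi (hx i h).symm, hiC⟩
    · push Not at hx
      set D := univ.filter fun i => u i ≠ w i with hD
      set E := C.filter fun c => ∀ i ∈ Dᶜ, c i = u i with hE
      have hEle : E.card ≤ 2 := by
        refine (card_le_card (t := {u, w}) fun x hxE => ?_).trans card_le_two
        obtain ⟨hxC, hxD⟩ := mem_filter.mp hxE
        by_contra hne
        simp only [mem_insert, mem_singleton, not_or] at hne
        obtain ⟨i, hi, hi'⟩ := hx x hxC hne.1 hne.2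
        exact hi' (hxD i (by simp [hD, hi]))
      have huE : u ∈ E := mem_filter.mpr ⟨hu, fun _ _ => rfl⟩
      have hwE : w ∈ E := mem_filter.mpr ⟨hw, fun i hi => by
        simpa [hD, eq_comm] using hi⟩
      have hsub : insert ∅ (D.image fun i => {i}) ⊆ shatteredSets E := by
        intro Y hY
        rw [mem_shatteredSets]
        intro p
        rcases mem_insert.mp hY with rfl | hY
        · exact ⟨u, huE, by simp⟩
        · obtain ⟨i, hi, rfl⟩ := mem_image.mp hY
          have hi : u i ≠ w i := by simpa [hD] using hi
          by_cases hp : u i = p i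
          · exact ⟨u, huE, by simpa using hp⟩
          · refine ⟨w, hwE, ?_⟩
            simp only [mem_singleton, forall_eq]
            exact (Bool.eq_not.mpr hi.symm).trans (Bool.eq_not.mpr (Ne.symm hp)).symm
      have hcard : D.card + 1 ≤ (shatteredSets E).card := by
        refine le_trans (le_of_eq ?_) (card_le_card hsub)
        rw [card_insert_of_notMem (by simp), card_image_of_injective _ singleton_injective]
      have hext : (shatteredSets E).card ≤ E.card := hC.subcube u Dᶜ
      have hDpos : D.card ≠ 0 := fun h => huw (hamming_eq_zero.mp h)
      obtain ⟨i, hi⟩ := card_eq_one.mp (show D.card = 1 by omega)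
      have hmem : ∀ j, u j ≠ w j ↔ j = i := fun j => by
        simpa [hD] using congrArg (j ∈ ·) hi
      have hne := (hmem i).mpr rfl
      refine ⟨i, hne, ?_⟩
      rwa [← eq_flip_of_forall_ne hne.symm fun j hj => by
        by_contra h
        exact hj ((hmem j).mp (Ne.symm h))]

theorem card_filter_card_le (n d : ℕ) :
    (univ.filter fun I : Finset (Fin n) => I.card ≤ d).card =
      ∑ i ∈ range (d + 1), n.choose i := by
  rw [card_eq_sum_card_fiberwise (f := card) (t := range (d + 1))
    fun I hI => by simpa [Nat.lt_succ_iff] using hI]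
  refine sum_congr rfl fun i hi => ?_
  rw [mem_range] at hi
  have : n.choose i = (powersetCard i (univ : Finset (Fin n))).card := by simp
  rw [this]
  congr 1
  ext I
  simp only [mem_filter, mem_univ, true_and, mem_powersetCard, subset_univ]
  omega

theorem IsMaximum.isExtremal {n d : ℕ} {C : Finset (Fin n → Bool)} (hC : IsMaximum C d) :
    IsExtremal C := by
  unfold IsExtremal
  rw [hC.2, ← card_filter_card_le]
  refine card_le_card fun Y hY => ?_
  simpa using hC.1.2 Y (mem_shatteredSets.mp hY)

theorem IsCornerPeeling.isometric_peeled {n : ℕ} {C : Finset (Fin n → Bool)}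
    {v : Fin C.card → (Fin n → Bool)} (hv : IsCornerPeeling C v) (hC : Isometric C)
    (t : Fin C.card) : Isometric (Peeled C v t) := by
  obtain ⟨t, ht⟩ := t
  induction t with
  | zero =>
    convert hC using 1
    unfold Peeled
    ext x
    simp [Fin.lt_def]
  | succ t ih =>
    have ht' : t < C.card := by omega
    convert (ih ht').erase_corner (hv.2.2 ⟨t, ht'⟩) using 1
    unfold Peeled
    ext x
    simp only [mem_sdiff, mem_image, mem_filter, mem_univ, true_and, mem_erase, not_exists,
      not_and, Fin.lt_def]
    constructor
    · rintro ⟨hx, h⟩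
      exact ⟨fun hxt => h ⟨t, ht'⟩ (Nat.lt_succ_self t) hxt.symm, hx,
        fun s hs => h s (Nat.lt_succ_of_lt hs)⟩
    · rintro ⟨hxt, hx, h⟩
      refine ⟨hx, fun s hs hsx => ?_⟩
      rcases Nat.lt_succ_iff_lt_or_eq.mp hs with hs | hs
      · exact h s hs hsx
      · have : s = ⟨t, ht'⟩ := Fin.ext hs
        subst this
        exact hxt hsx.symm

theorem IsCornerPeeling.mem_peeled {n : ℕ} {C : Finset (Fin n → Bool)}
    {v : Fin C.card → (Fin n → Bool)} (hv : IsCornerPeeling C v) {s t : Fin C.card}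
    (hst : s ≤ t) : v t ∈ Peeled C v s := by
  refine mem_sdiff.mpr ⟨hv.2.1 t, fun h => ?_⟩
  obtain ⟨q, hq, hqt⟩ := mem_image.mp h
  exact absurd (hv.1 hqt ▸ (mem_filter.mp hq).2) (not_lt.mpr hst)

theorem peeled_anti {n m : ℕ} (C : Finset (Fin n → Bool)) (v : Fin m → (Fin n → Bool))
    {s t : Fin m} (hst : s ≤ t) : Peeled C v t ⊆ Peeled C v s := by
  refine sdiff_subset_sdiff Subset.rfl (image_subset_image fun q hq => ?_)
  simp only [mem_filter, mem_univ, true_and] at hq ⊢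
  exact hq.trans_le hst

theorem notMem_peeled {n m : ℕ} (C : Finset (Fin n → Bool)) (v : Fin m → (Fin n → Bool))
    {s t : Fin m} (hst : s < t) : v s ∉ Peeled C v t := fun h =>
  (mem_sdiff.mp h).2 (mem_image_of_mem v (by simpa using hst))

/-- Any concept surviving step `s` differs from `v s` on the incident colors of `v s`. -/
theorem IsCornerPeeling.exists_ne_of_mem {n : ℕ} {C : Finset (Fin n → Bool)}
    {v : Fin C.card → (Fin n → Bool)} (hv : IsCornerPeeling C v) (hC : Isometric C)
    {s : Fin C.card} {w : Fin n → Bool} (hw : w ∈ Peeled C v s) (hne : v s ≠ w) :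
    ∃ i ∈ incidentColors (Peeled C v s) (v s), v s i ≠ w i := by
  obtain ⟨i, hi, hiC⟩ := hv.isometric_peeled hC s _ (hv.mem_peeled le_rfl) w hw hne
  exact ⟨i, mem_incidentColors.mpr hiC, hi⟩

theorem IsCornerPeeling.incidentColors_ne {n : ℕ} {C : Finset (Fin n → Bool)}
    {v : Fin C.card → (Fin n → Bool)} (hv : IsCornerPeeling C v) (hC : Isometric C)
    {s t : Fin C.card} (hst : s < t) :
    incidentColors (Peeled C v s) (v s) ≠ incidentColors (Peeled C v t) (v t) := by
  intro h
  obtain ⟨Q, hQ, -⟩ := (hv.2.2 t).exists_isCube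
  obtain ⟨u, hu, hus⟩ := hQ.2.2 (v s)
  have hut := hQ.1 hu
  obtain ⟨i, hi, hne⟩ := hv.exists_ne_of_mem hC (peeled_anti C v hst.le hut)
    (fun hsu => notMem_peeled C v hst (hsu ▸ hut))
  exact hne (hus i (h ▸ hi)).symm

/-- If a `d`-maximum class `C` can be corner-peeled, then the map `r`
sending each peeled vertex to the colors of its incident edges at peeling time is a
bijection between `C` and the subsets of coordinates of size at most `d`, and is
non-clashing; hence it is an unlabeled compression scheme of size `d`. -/
theorem stmt1 (n d : ℕ) (C : Finset (Fin n → Bool)) (hC : IsMaximum C d)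
    (v : Fin C.card → (Fin n → Bool)) (hv : IsCornerPeeling C v) :
    (Function.Injective fun t => incidentColors (Peeled C v t) (v t)) ∧
    (∀ I : Finset (Fin n), I.card ≤ d ↔ ∃ t, incidentColors (Peeled C v t) (v t) = I) ∧
    (∀ s t : Fin C.card, s ≠ t →
      ∃ i ∈ incidentColors (Peeled C v s) (v s) ∪ incidentColors (Peeled C v t) (v t),
        v s i ≠ v t i) := by
  have hiso := hC.isExtremal.isometric
  have hinj : Function.Injective fun t => incidentColors (Peeled C v t) (v t) := by
    intro s t hst
    rcases lt_trichotomy s t with h | h | h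
    · exact absurd hst (hv.incidentColors_ne hiso h)
    · exact h
    · exact absurd hst.symm (hv.incidentColors_ne hiso h)
  have hle : ∀ t, (incidentColors (Peeled C v t) (v t)).card ≤ d := fun t => by
    obtain ⟨Q, hQ, -⟩ := (hv.2.2 t).exists_isCube
    exact hC.1.2 _ (hQ.shatters.mono sdiff_subset)
  have himage : univ.image (fun t => incidentColors (Peeled C v t) (v t)) =
      univ.filter fun I : Finset (Fin n) => I.card ≤ d := by
    refine eq_of_subset_of_card_le (fun I hI => ?_) ?_
    · obtain ⟨t, -, rfl⟩ := mem_image.mp hI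
      simpa using hle t
    · rw [card_image_of_injective _ hinj, card_filter_card_le, card_univ, Fintype.card_fin,
        hC.2]
  refine ⟨hinj, fun I => ?_, fun s t hst => ?_⟩
  · simpa using (congrArg (I ∈ ·) himage).symm
  · rcases lt_or_gt_of_ne hst with h | h
    · obtain ⟨i, hi, hne⟩ := hv.exists_ne_of_mem hiso (hv.mem_peeled h.le) (hv.1.ne hst)
      exact ⟨i, mem_union_left _ hi, hne⟩
    · obtain ⟨i, hi, hne⟩ := hv.exists_ne_of_mem hiso (hv.mem_peeled h.le) (hv.1.ne hst.symm)
      exact ⟨i, mem_union_right _ hi, hne.symm⟩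

end GeomCompress
end

section
/- Every d-maximum class C ⊆ {0,1}^n with 1 ≤ d ≤ n admits an unlabeled compression scheme of size d: there is a bijection r between C and the subsets of {1,…,n} of cardinality at most d such that for all distinct c, c' ∈ C the restrictions of c and c' to r(c) ∪ r(c') differ. -/
open Finset

namespace GeomCompress

/-- `𝒜` is a maximum family of subsets of `Y`: it shatters no set with more than `d` elements
and attains the Sauer–Shelah bound. -/
structure MaximumOn {α : Type*} [DecidableEq α] (Y : Finset α) (d : ℕ)
    (𝒜 : Finset (Finset α)) : Prop where
  subset : ∀ A ∈ 𝒜, A ⊆ Y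
  card_le_of_shatters : ∀ S, 𝒜.Shatters S → #S ≤ d
  card_eq : #𝒜 = ∑ i ∈ range (d + 1), (#Y).choose i

/-- `r` is an injective, non-clashing map from `𝒜` to the subsets of `Y` with at most `d`
elements. -/
structure IsRepresentation {α : Type*} [DecidableEq α] (Y : Finset α) (d : ℕ)
    (𝒜 : Finset (Finset α)) (r : Finset α → Finset α) : Prop where
  subset : ∀ A ∈ 𝒜, r A ⊆ Y
  card_le : ∀ A ∈ 𝒜, #(r A) ≤ d
  injOn : ∀ A ∈ 𝒜, ∀ B ∈ 𝒜, r A = r B → A = B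
  ne_inter : ∀ A ∈ 𝒜, ∀ B ∈ 𝒜, A ≠ B → A ∩ (r A ∪ r B) ≠ B ∩ (r A ∪ r B)

section SetFamily

variable {α : Type*} [DecidableEq α]

theorem card_biUnion_powersetCard (Y : Finset α) (d : ℕ) :
    #((range (d + 1)).biUnion fun i => powersetCard i Y) =
      ∑ i ∈ range (d + 1), (#Y).choose i := by
  rw [card_biUnion]
  · simp
  · intro i _ j _ hij
    exact pairwise_disjoint_powersetCard Y hij

theorem shatterer_subset_biUnion_powersetCard {Y : Finset α} {d : ℕ} {𝒜 : Finset (Finset α)}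
    (hY : ∀ A ∈ 𝒜, A ⊆ Y) (hd : ∀ S, 𝒜.Shatters S → #S ≤ d) :
    𝒜.shatterer ⊆ (range (d + 1)).biUnion fun i => powersetCard i Y := by
  intro S hS
  rw [mem_shatterer] at hS
  obtain ⟨t, ht, hSt⟩ := hS.exists_superset
  simp only [mem_biUnion, mem_range, mem_powersetCard]
  exact ⟨#S, Nat.lt_succ_of_le (hd S hS), hSt.trans (hY t ht), rfl⟩

theorem card_le_sum_choose {Y : Finset α} {d : ℕ} {𝒜 : Finset (Finset α)}
    (hY : ∀ A ∈ 𝒜, A ⊆ Y) (hd : ∀ S, 𝒜.Shatters S → #S ≤ d) :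
    #𝒜 ≤ ∑ i ∈ range (d + 1), (#Y).choose i := by
  rw [← card_biUnion_powersetCard]
  exact (card_le_card_shatterer 𝒜).trans
    (card_le_card (shatterer_subset_biUnion_powersetCard hY hd))

theorem sum_choose_succ (k d : ℕ) :
    ∑ i ∈ range (d + 1 + 1), (k + 1).choose i =
      ∑ i ∈ range (d + 1 + 1), k.choose i + ∑ i ∈ range (d + 1), k.choose i := by
  rw [sum_range_succ', sum_range_succ' (fun i => k.choose i) (d + 1)]
  simp only [Nat.choose_succ_succ', sum_add_distrib, Nat.choose_zero_right]
  ring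

/-- The sets avoiding `x` both of whose extensions along `x` belong to `𝒜`. -/
def reduction (𝒜 : Finset (Finset α)) (x : α) : Finset (Finset α) :=
  𝒜.memberSubfamily x ∩ 𝒜.nonMemberSubfamily x

theorem mem_reduction {𝒜 : Finset (Finset α)} {x : α} {A : Finset α} :
    A ∈ reduction 𝒜 x ↔ insert x A ∈ 𝒜 ∧ A ∈ 𝒜 ∧ x ∉ A := by
  simp only [reduction, mem_inter, mem_memberSubfamily, mem_nonMemberSubfamily]
  tauto

theorem reduction_subset_image_erase (𝒜 : Finset (Finset α)) (x : α) :
    reduction 𝒜 x ⊆ 𝒜.image (·.erase x) := by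
  rw [← memberSubfamily_union_nonMemberSubfamily]
  exact inter_subset_left.trans subset_union_left

theorem card_image_erase_add_card_reduction (𝒜 : Finset (Finset α)) (x : α) :
    #(𝒜.image (·.erase x)) + #(reduction 𝒜 x) = #𝒜 := by
  rw [← memberSubfamily_union_nonMemberSubfamily, reduction, card_union_add_card_inter,
    card_memberSubfamily_add_card_nonMemberSubfamily]

theorem shatters_of_shatters_image_erase {𝒜 : Finset (Finset α)} {x : α} {S : Finset α}
    (h : (𝒜.image (·.erase x)).Shatters S) : 𝒜.Shatters S := by
  have hx : x ∉ S := by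
    intro hx
    obtain ⟨t, ht, hSt⟩ := h.exists_superset
    obtain ⟨A, -, rfl⟩ := mem_image.1 ht
    exact notMem_erase x A (hSt hx)
  intro t ht
  obtain ⟨u, hu, rfl⟩ := h ht
  obtain ⟨A, hA, rfl⟩ := mem_image.1 hu
  refine ⟨A, hA, ?_⟩
  rw [inter_erase, erase_eq_of_notMem (by simp [hx])]

theorem shatters_insert_of_shatters_reduction {𝒜 : Finset (Finset α)} {x : α} {S : Finset α}
    (h : (reduction 𝒜 x).Shatters S) : 𝒜.Shatters (insert x S) ∧ x ∉ S := by
  have hx : x ∉ S := by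
    intro hx
    obtain ⟨t, ht, hSt⟩ := h.exists_superset
    exact (mem_reduction.1 ht).2.2 (hSt hx)
  refine ⟨fun t ht => ?_, hx⟩
  obtain ⟨u, hu, hut⟩ := h (t := t.erase x) (by rwa [← subset_insert_iff])
  obtain ⟨h1, h2, h3⟩ := mem_reduction.1 hu
  by_cases hxt : x ∈ t
  · refine ⟨insert x u, h1, ?_⟩
    rw [← insert_inter_distrib, hut, insert_erase hxt]
  · refine ⟨u, h2, ?_⟩
    rw [insert_inter_of_notMem h3, hut, erase_eq_of_notMem hxt]

theorem card_le_of_shatters_reduction {𝒜 : Finset (Finset α)} {x : α} {d : ℕ}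
    (hd : ∀ S, 𝒜.Shatters S → #S ≤ d + 1) (S : Finset α) (h : (reduction 𝒜 x).Shatters S) :
    #S ≤ d := by
  obtain ⟨h1, h2⟩ := shatters_insert_of_shatters_reduction h
  have := hd _ h1
  rw [card_insert_of_notMem h2] at this
  omega

namespace MaximumOn

variable {Y : Finset α} {d : ℕ} {𝒜 : Finset (Finset α)} {x : α}

theorem card_image_erase_and_reduction (h : MaximumOn Y (d + 1) 𝒜) (hx : x ∈ Y) :
    MaximumOn (Y.erase x) (d + 1) (𝒜.image (·.erase x)) ∧
      MaximumOn (Y.erase x) d (reduction 𝒜 x) := by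
  have s1 : ∀ A ∈ 𝒜.image (·.erase x), A ⊆ Y.erase x := by
    intro A hA
    obtain ⟨B, hB, rfl⟩ := mem_image.1 hA
    exact erase_subset_erase x (h.subset B hB)
  have s2 : ∀ A ∈ reduction 𝒜 x, A ⊆ Y.erase x := fun A hA =>
    s1 A (reduction_subset_image_erase 𝒜 x hA)
  have v1 : ∀ S, (𝒜.image (·.erase x)).Shatters S → #S ≤ d + 1 := fun S hS =>
    h.card_le_of_shatters S (shatters_of_shatters_image_erase hS)
  have v2 := card_le_of_shatters_reduction (x := x) h.card_le_of_shatters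
  have c1 := card_le_sum_choose s1 v1
  have c2 := card_le_sum_choose s2 v2
  have c3 := card_image_erase_add_card_reduction 𝒜 x
  have c4 := sum_choose_succ (#(Y.erase x)) d
  rw [card_erase_add_one hx, ← h.card_eq] at c4
  exact ⟨⟨s1, v1, by omega⟩, ⟨s2, v2, by omega⟩⟩

theorem card_eq_one (h : MaximumOn Y 0 𝒜) : #𝒜 = 1 := by
  simpa using h.card_eq

theorem image_erase (h : MaximumOn Y d 𝒜) (hx : x ∈ Y) :
    MaximumOn (Y.erase x) d (𝒜.image (·.erase x)) := by
  cases d with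
  | succ d => exact (h.card_image_erase_and_reduction hx).1
  | zero =>
    obtain ⟨A, rfl⟩ := Finset.card_eq_one.1 h.card_eq_one
    refine ⟨?_, fun S hS => h.card_le_of_shatters S (shatters_of_shatters_image_erase hS), ?_⟩
    · simpa using erase_subset_erase x (h.subset A (by simp))
    · simp

theorem image_sdiff (h : MaximumOn Y d 𝒜) (Z : Finset α) :
    MaximumOn (Y \ Z) d (𝒜.image (· \ Z)) := by
  induction Z using Finset.induction_on with
  | empty => simpa using h
  | insert x Z _ ih =>
    have himage : 𝒜.image (· \ insert x Z) = (𝒜.image (· \ Z)).image (·.erase x) := by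
      rw [image_image]
      exact image_congr fun A _ => sdiff_insert A Z x
    rw [himage, sdiff_insert]
    by_cases hx : x ∈ Y \ Z
    · exact ih.image_erase hx
    · have hid : (𝒜.image (· \ Z)).image (·.erase x) = 𝒜.image (· \ Z) := by
        conv_rhs => rw [← image_id (s := 𝒜.image (· \ Z))]
        exact image_congr fun A hA => erase_eq_of_notMem fun hxA => hx (ih.subset A hA hxA)
      rwa [hid, erase_eq_of_notMem hx]

/-- Every `d`-subset of `Y` is the support of a `d`-dimensional cube of `𝒜`. -/
theorem exists_cube (h : MaximumOn Y d 𝒜) {σ : Finset α} (hσ : σ ⊆ Y) (hc : #σ = d) :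
    ∃ B, Disjoint B σ ∧ ∀ T ⊆ σ, B ∪ T ∈ 𝒜 := by
  induction σ using Finset.induction_on generalizing Y d 𝒜 with
  | empty =>
    subst hc
    obtain ⟨A, rfl⟩ := Finset.card_eq_one.1 h.card_eq_one
    exact ⟨A, by simp, fun T hT => by simp [subset_empty.1 hT]⟩
  | insert x σ hx ih =>
    rw [card_insert_of_notMem hx] at hc
    subst hc
    obtain ⟨hxY, hσY⟩ := insert_subset_iff.1 hσ
    obtain ⟨B, hB, hT⟩ := ih (h.card_image_erase_and_reduction hxY).2
      (subset_erase.2 ⟨hσY, hx⟩) rfl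
    have hxB : x ∉ B := by
      have := (mem_reduction.1 (hT ∅ (empty_subset _))).2.2
      simpa using this
    refine ⟨B, disjoint_insert_right.2 ⟨hxB, hB⟩, fun T hTs => ?_⟩
    obtain ⟨h1, h2, -⟩ := mem_reduction.1 (hT (T.erase x) (subset_insert_iff.1 hTs))
    by_cases hxT : x ∈ T
    · rwa [← union_insert, insert_erase hxT] at h1
    · rwa [erase_eq_of_notMem hxT] at h2

theorem exists_missing (h : MaximumOn Y d 𝒜) {σ : Finset α} (hc : #σ = d + 1) :
    ∃ p ⊆ σ, ∀ A ∈ 𝒜, A ∩ σ ≠ p := by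
  by_contra! hcon
  have := h.card_le_of_shatters σ fun t ht => by
    obtain ⟨A, hA, hAt⟩ := hcon t ht
    exact ⟨A, hA, by rwa [inter_comm]⟩
  omega

end MaximumOn

/-- A sign for `A` relative to the pattern `p` on `σ`. -/
def patternSign (σ p A : Finset α) : ℤ :=
  ∏ j ∈ σ, if j ∈ A ↔ j ∈ p then 1 else -1

theorem patternSign_symmDiff_singleton {σ : Finset α} (p A : Finset α) {i : α} (hi : i ∈ σ) :
    patternSign σ p (symmDiff A {i}) = -patternSign σ p A := by
  unfold patternSign
  rw [← mul_prod_erase σ _ hi, ← mul_prod_erase σ (fun j => if j ∈ A ↔ j ∈ p then (1 : ℤ) else -1) hi,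
    ← neg_mul]
  congr 1
  · by_cases h1 : i ∈ A <;> by_cases h2 : i ∈ p <;> simp [mem_symmDiff, h1, h2]
  · refine prod_congr rfl fun j hj => ?_
    simp [mem_symmDiff, ne_of_mem_erase hj]

theorem patternSign_eq_one {σ p A : Finset α} (h : A ∩ σ = p) : patternSign σ p A = 1 := by
  subst h
  refine prod_eq_one fun j hj => ?_
  simp [hj]

/-- Signed sum over a cube of the indicator of a pattern on another set. -/
theorem sum_patternSign_cube {𝒜 : Finset (Finset α)} {σ τ B p q : Finset α}
    (hB : Disjoint B σ) (hp : p ⊆ σ) (hcube : ∀ T ⊆ σ, B ∪ T ∈ 𝒜) (hc : #σ = #τ)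
    (hpq : σ = τ → p = q) :
    ∑ A ∈ 𝒜, (if A \ σ = B then patternSign σ p A else 0) * (if A ∩ τ = q then 1 else 0) =
      if σ = τ then 1 else 0 := by
  split_ifs with hστ
  · obtain rfl := hpq hστ
    subst hστ
    have hBp : (B ∪ p) ∩ σ = p := by
      rw [union_inter_distrib_right, disjoint_iff_inter_eq_empty.1 hB, empty_union,
        inter_eq_left.2 hp]
    rw [sum_eq_single (B ∪ p)]
    · rw [if_pos hBp, if_pos, patternSign_eq_one hBp, mul_one]
      rw [union_sdiff_distrib, sdiff_eq_self_of_disjoint hB, sdiff_eq_empty_iff_subset.2 hp,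
        union_empty]
    · intro A _ hne
      by_cases h1 : A \ σ = B
      · by_cases h2 : A ∩ σ = p
        · exact absurd (by rw [← h1, ← h2, sdiff_union_inter]) hne
        · simp [h2]
      · simp [h1]
    · intro h
      exact absurd (hcube p hp) h
  · obtain ⟨i, hiσ, hiτ⟩ : ∃ i ∈ σ, i ∉ τ := by
      by_contra! hcon
      exact hστ (eq_of_subset_of_card_le hcon hc.ge)
    have hsd : ∀ A : Finset α, symmDiff A {i} \ σ = A \ σ := by
      intro A
      ext j
      by_cases hj : j = i
      · subst hj; simp [hiσ]
      · simp [mem_symmDiff, hj]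
    have hin : ∀ A : Finset α, symmDiff A {i} ∩ τ = A ∩ τ := by
      intro A
      ext j
      by_cases hj : j = i
      · subst hj; simp [hiτ]
      · simp [mem_symmDiff, hj]
    have hmem : ∀ A : Finset α, A \ σ = B → A ∈ 𝒜 := by
      intro A hA
      rw [← sdiff_union_inter A σ, hA]
      exact hcube _ inter_subset_right
    have hsum : ∑ A ∈ 𝒜 with A \ σ = B,
        patternSign σ p A * (if A ∩ τ = q then 1 else 0) = 0 := by
      refine sum_involution (fun A _ => symmDiff A {i}) ?_ ?_ ?_ ?_
      · intro A _
        rw [hin, patternSign_symmDiff_singleton p A hiσ]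
        ring
      · intro A _ _ h
        simp at h
      · intro A hA
        rw [mem_filter] at hA ⊢
        exact ⟨hmem _ ((hsd A).trans hA.2), (hsd A).trans hA.2⟩
      · intro A _
        simp
    rw [sum_filter] at hsum
    simpa only [ite_mul, zero_mul] using hsum

/-- Vertices of cubes of `𝒜` realizing patterns missed by `𝒟` are pairwise distinct, provided
there are exactly as many cubes as elements of `𝒜 \ 𝒟`. -/
theorem source_injOn {𝒜 𝒟 P : Finset (Finset α)} {d : ℕ} {B p : Finset α → Finset α}
    (hcard : #P = #(𝒜 \ 𝒟)) (hP : ∀ σ ∈ P, #σ = d)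
    (hB : ∀ σ ∈ P, Disjoint (B σ) σ) (hp : ∀ σ ∈ P, p σ ⊆ σ)
    (hcube : ∀ σ ∈ P, ∀ T ⊆ σ, B σ ∪ T ∈ 𝒜) (hmiss : ∀ σ ∈ P, ∀ A ∈ 𝒟, A ∩ σ ≠ p σ) :
    ∀ σ ∈ P, ∀ τ ∈ P, B σ ∪ p σ = B τ ∪ p τ → σ = τ := by
  let M : Matrix P ↥(𝒜 \ 𝒟) ℤ := fun σ A =>
    if A.1 \ σ.1 = B σ then patternSign σ.1 (p σ) A.1 else 0
  let N : Matrix ↥(𝒜 \ 𝒟) P ℤ := fun A σ => if A.1 ∩ σ.1 = p σ then 1 else 0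
  have hMN : M * N = 1 := by
    ext ⟨σ, hσ⟩ ⟨τ, hτ⟩
    rw [Matrix.mul_apply, Matrix.one_apply]
    have := sum_patternSign_cube (hB σ hσ) (hp σ hσ) (hcube σ hσ)
      ((hP σ hσ).trans (hP τ hτ).symm) (q := p τ) (fun h => by rw [h])
    simp only [Subtype.mk.injEq]
    rw [← this, sum_coe_sort (𝒜 \ 𝒟) fun A =>
      (if A \ σ = B σ then patternSign σ (p σ) A else 0) * (if A ∩ τ = p τ then 1 else 0)]
    refine sum_subset sdiff_subset fun A hA hA' => ?_
    have hAD : A ∈ 𝒟 := by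
      by_contra hcon
      exact hA' (mem_sdiff.2 ⟨hA, hcon⟩)
    rw [if_neg (hmiss τ hτ A hAD), mul_zero]
  have hNM : N * M = 1 :=
    (Matrix.mul_eq_one_comm_of_card_eq _ _ _ (by simpa using hcard)).1 hMN
  have hsource : ∀ σ ∈ P, (B σ ∪ p σ) \ σ = B σ ∧ (B σ ∪ p σ) ∩ σ = p σ := by
    intro σ hσ
    constructor
    · rw [union_sdiff_distrib, sdiff_eq_self_of_disjoint (hB σ hσ),
        sdiff_eq_empty_iff_subset.2 (hp σ hσ), union_empty]
    · rw [union_inter_distrib_right, disjoint_iff_inter_eq_empty.1 (hB σ hσ), empty_union,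
        inter_eq_left.2 (hp σ hσ)]
  intro σ hσ τ hτ hst
  by_contra hne
  have hA : B σ ∪ p σ ∈ 𝒜 \ 𝒟 :=
    mem_sdiff.2 ⟨hcube σ hσ _ (hp σ hσ), fun h => hmiss σ hσ _ h (hsource σ hσ).2⟩
  have hdiag := congrFun (congrFun hNM ⟨_, hA⟩) ⟨_, hA⟩
  rw [Matrix.mul_apply, Matrix.one_apply_eq] at hdiag
  have hnonneg : ∀ ρ : P, 0 ≤ N ⟨_, hA⟩ ρ * M ρ ⟨_, hA⟩ := by
    intro ρ
    simp only [N, M]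
    split_ifs with h1 h2 <;> simp
    rw [patternSign_eq_one h1]
    exact zero_le_one
  have hone : ∀ ρ (hρ : ρ ∈ P), B ρ ∪ p ρ = B σ ∪ p σ →
      N ⟨_, hA⟩ ⟨ρ, hρ⟩ * M ⟨ρ, hρ⟩ ⟨_, hA⟩ = 1 := by
    intro ρ hρ h
    have h' := hsource ρ hρ
    rw [h] at h'
    simp only [N, M]
    rw [if_pos h'.1, if_pos h'.2, patternSign_eq_one h'.2, one_mul]
  have hle := sum_le_sum_of_subset_of_nonneg (subset_univ {(⟨σ, hσ⟩ : P), ⟨τ, hτ⟩})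
    fun ρ _ _ => hnonneg ρ
  rw [hdiag, sum_pair (by simpa using hne), hone σ hσ rfl, hone τ hτ hst.symm] at hle
  norm_num at hle

namespace MaximumOn

variable {Y : Finset α} {d : ℕ} {𝒜 𝒟 : Finset (Finset α)}

theorem card_sdiff_eq_choose (h : MaximumOn Y (d + 1) 𝒜) (h' : MaximumOn Y d 𝒟)
    (hsub : 𝒟 ⊆ 𝒜) : #(𝒜 \ 𝒟) = (#Y).choose (d + 1) := by
  rw [card_sdiff_of_subset hsub, h.card_eq, h'.card_eq, sum_range_succ _ (d + 1)]
  omega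

/-- Sources of distinct cubes already differ on the union of the supports. -/
theorem source_inter_ne (h : MaximumOn Y (d + 1) 𝒜) (h' : MaximumOn Y d 𝒟) (hsub : 𝒟 ⊆ 𝒜)
    {B p : Finset α → Finset α}
    (hB : ∀ σ ∈ powersetCard (d + 1) Y, Disjoint (B σ) σ)
    (hp : ∀ σ ∈ powersetCard (d + 1) Y, p σ ⊆ σ)
    (hcube : ∀ σ ∈ powersetCard (d + 1) Y, ∀ T ⊆ σ, B σ ∪ T ∈ 𝒜)
    (hmiss : ∀ σ ∈ powersetCard (d + 1) Y, ∀ A ∈ 𝒟, A ∩ σ ≠ p σ)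
    {σ τ : Finset α} (hσ : σ ∈ powersetCard (d + 1) Y) (hτ : τ ∈ powersetCard (d + 1) Y)
    (hne : σ ≠ τ) :
    (B σ ∪ p σ) ∩ (σ ∪ τ) ≠ (B τ ∪ p τ) ∩ (σ ∪ τ) := by
  set U := σ ∪ τ with hU
  set Z := Y \ U with hZ
  have hUY : U ⊆ Y :=
    union_subset (mem_powersetCard.1 hσ).1 (mem_powersetCard.1 hτ).1
  have hYZ : Y \ Z = U := by rw [hZ, Finset.sdiff_sdiff_eq_self hUY]
  have hsdiff_eq : ∀ A ⊆ Y, A \ Z = A ∩ U := by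
    intro A hA
    ext j
    have := @hA j
    simp only [hZ, mem_sdiff, mem_inter]
    tauto
  have h1 := h.image_sdiff Z
  have h1' := h'.image_sdiff Z
  rw [hYZ] at h1 h1'
  have hpow : powersetCard (d + 1) U ⊆ powersetCard (d + 1) Y := powersetCard_mono hUY
  have hdisj : ∀ ρ ⊆ U, ρ \ Z = ρ := by
    intro ρ hρ
    rw [hsdiff_eq ρ (hρ.trans hUY), inter_eq_left.2 hρ]
  have hσU : σ ∈ powersetCard (d + 1) U :=
    mem_powersetCard.2 ⟨subset_union_left, (mem_powersetCard.1 hσ).2⟩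
  have hτU : τ ∈ powersetCard (d + 1) U :=
    mem_powersetCard.2 ⟨subset_union_right, (mem_powersetCard.1 hτ).2⟩
  have hinj := source_injOn (P := powersetCard (d + 1) U) (d := d + 1)
    (B := fun ρ => B ρ \ Z) (p := p)
    (by rw [h1.card_sdiff_eq_choose h1' (image_subset_image hsub), card_powersetCard])
    (fun ρ hρ => (mem_powersetCard.1 hρ).2)
    (fun ρ hρ => (hB ρ (hpow hρ)).mono_left sdiff_subset)
    (fun ρ hρ => hp ρ (hpow hρ))
    (fun ρ hρ T hT => mem_image.2 ⟨B ρ ∪ T, hcube ρ (hpow hρ) T hT, by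
      rw [union_sdiff_distrib, hdisj T (hT.trans (mem_powersetCard.1 hρ).1)]⟩)
    (fun ρ hρ A hA => by
      obtain ⟨A', hA', rfl⟩ := mem_image.1 hA
      rw [hsdiff_eq A' (h'.subset A' hA'), inter_assoc, inter_eq_right.2 (mem_powersetCard.1 hρ).1]
      exact hmiss ρ (hpow hρ) A' hA')
  have hrestrict : ∀ ρ ∈ powersetCard (d + 1) U, B ρ \ Z ∪ p ρ = (B ρ ∪ p ρ) ∩ U := by
    intro ρ hρ
    rw [← hsdiff_eq _ (h.subset _ (hcube ρ (hpow hρ) _ (hp ρ (hpow hρ)))), union_sdiff_distrib,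
      hdisj (p ρ) ((hp ρ (hpow hρ)).trans (mem_powersetCard.1 hρ).1)]
  intro heq
  refine hne (hinj σ hσU τ hτU ?_)
  rw [hrestrict σ hσU, hrestrict τ hτU, heq]

/-- A representation of a maximum subfamily of dimension one less extends. -/
theorem exists_extension (h : MaximumOn Y (d + 1) 𝒜) (h' : MaximumOn Y d 𝒟) (hsub : 𝒟 ⊆ 𝒜)
    {r : Finset α → Finset α} (hr : IsRepresentation Y d 𝒟 r) :
    ∃ r', IsRepresentation Y (d + 1) 𝒜 r' ∧ ∀ A ∈ 𝒟, #(r' A) ≤ d := by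
  have hex : ∀ σ, ∃ B p, σ ∈ powersetCard (d + 1) Y →
      Disjoint B σ ∧ (∀ T ⊆ σ, B ∪ T ∈ 𝒜) ∧ p ⊆ σ ∧ ∀ A ∈ 𝒟, A ∩ σ ≠ p := by
    intro σ
    by_cases hσ : σ ∈ powersetCard (d + 1) Y
    · obtain ⟨hσY, hc⟩ := mem_powersetCard.1 hσ
      obtain ⟨B, hB, hcube⟩ := h.exists_cube hσY hc
      obtain ⟨p, hp, hmiss⟩ := h'.exists_missing hc
      exact ⟨B, p, fun _ => ⟨hB, hcube, hp, hmiss⟩⟩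
    · exact ⟨∅, ∅, fun hσ' => absurd hσ' hσ⟩
  choose B p hBp using hex
  set s : Finset α → Finset α := fun σ => B σ ∪ p σ with hs
  have hsource : ∀ σ ∈ powersetCard (d + 1) Y, s σ ∩ σ = p σ := by
    intro σ hσ
    obtain ⟨hB, -, hp, -⟩ := hBp σ hσ
    rw [hs, union_inter_distrib_right, disjoint_iff_inter_eq_empty.1 hB, empty_union,
      inter_eq_left.2 hp]
  have hsne : ∀ σ ∈ powersetCard (d + 1) Y, ∀ τ ∈ powersetCard (d + 1) Y, σ ≠ τ →
      s σ ∩ (σ ∪ τ) ≠ s τ ∩ (σ ∪ τ) := fun σ hσ τ hτ hne =>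
    h.source_inter_ne h' hsub (fun σ hσ => (hBp σ hσ).1) (fun σ hσ => (hBp σ hσ).2.2.1)
      (fun σ hσ => (hBp σ hσ).2.1) (fun σ hσ => (hBp σ hσ).2.2.2) hσ hτ hne
  have hsurj : ∀ A ∈ 𝒜 \ 𝒟, ∃ σ ∈ powersetCard (d + 1) Y, s σ = A := by
    intro A hA
    have := surj_on_of_inj_on_of_card_le (s := powersetCard (d + 1) Y) (t := 𝒜 \ 𝒟)
      (fun σ _ => s σ)
      (fun σ hσ => mem_sdiff.2 ⟨(hBp σ hσ).2.1 _ (hBp σ hσ).2.2.1, fun hD =>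
        (hBp σ hσ).2.2.2 _ hD (hsource σ hσ)⟩)
      (fun σ τ hσ hτ heq => by
        by_contra hne
        exact hsne σ hσ τ hτ hne (by rw [heq]))
      (by rw [h.card_sdiff_eq_choose h' hsub, card_powersetCard]) A hA
    obtain ⟨σ, hσ, heq⟩ := this
    exact ⟨σ, hσ, heq.symm⟩
  choose! t ht hst using hsurj
  refine ⟨fun A => if A ∈ 𝒟 then r A else t A, ?_, fun A hA => by simpa [hA] using hr.card_le A hA⟩
  have hnew : ∀ A ∈ 𝒜, A ∉ 𝒟 → t A ∈ powersetCard (d + 1) Y ∧ s (t A) = A := fun A hA hD =>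
    ⟨ht A (mem_sdiff.2 ⟨hA, hD⟩), hst A (mem_sdiff.2 ⟨hA, hD⟩)⟩
  have hmixed : ∀ A ∈ 𝒟, ∀ A' ∈ 𝒜, A' ∉ 𝒟 → ∀ V, t A' ⊆ V → A ∩ V ≠ A' ∩ V := by
    intro A hA A' hA' hD V hV heq
    obtain ⟨h1, h2⟩ := hnew A' hA' hD
    refine (hBp _ h1).2.2.2 A hA ?_
    rw [← hsource _ h1, h2, ← inter_eq_right.2 hV, ← inter_assoc, heq, inter_assoc]
  refine ⟨fun A hA => ?_, fun A hA => ?_, fun A hA A' hA' heq => ?_, fun A hA A' hA' hne => ?_⟩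
  · split_ifs with hD
    · exact hr.subset A hD
    · exact (mem_powersetCard.1 (hnew A hA hD).1).1
  · split_ifs with hD
    · exact (hr.card_le A hD).trans (Nat.le_succ d)
    · exact (mem_powersetCard.1 (hnew A hA hD).1).2.le
  · split_ifs at heq with hD hD' hD'
    · exact hr.injOn A hD A' hD' heq
    · have h1 := hr.card_le A hD
      rw [heq, (mem_powersetCard.1 (hnew A' hA' hD').1).2] at h1
      omega
    · have h1 := hr.card_le A' hD'
      rw [← heq, (mem_powersetCard.1 (hnew A hA hD).1).2] at h1
      omega
    · rw [← (hnew A hA hD).2, ← (hnew A' hA' hD').2, heq]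
  · split_ifs with hD hD' hD'
    · exact hr.ne_inter A hD A' hD' hne
    · exact hmixed A hD A' hA' hD' _ subset_union_right
    · exact (hmixed A' hD' A hA hD _ subset_union_left).symm
    · obtain ⟨h1, h2⟩ := hnew A hA hD
      obtain ⟨h3, h4⟩ := hnew A' hA' hD'
      have := hsne _ h1 _ h3 fun heq => hne (by rw [← h2, ← h4, heq])
      rwa [h2, h4] at this

end MaximumOn

theorem isRepresentation_empty {Y : Finset α} {d : ℕ} {𝒜 : Finset (Finset α)} (h : #𝒜 = 1) :
    IsRepresentation Y d 𝒜 fun _ => ∅ := by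
  obtain ⟨A, rfl⟩ := card_eq_one.1 h
  constructor <;> simp

/-- A representation of the restriction of `𝒜` away from `x`, of size smaller by one on the
reduction, lifts to a representation of `𝒜`. -/
theorem IsRepresentation.lift {Y : Finset α} {d : ℕ} {𝒜 : Finset (Finset α)} {x : α}
    {r : Finset α → Finset α} (hx : x ∈ Y)
    (hr : IsRepresentation (Y.erase x) (d + 1) (𝒜.image (·.erase x)) r)
    (hred : ∀ A ∈ reduction 𝒜 x, #(r A) ≤ d) :
    IsRepresentation Y (d + 1) 𝒜 fun A =>
      if x ∈ A ∧ A.erase x ∈ reduction 𝒜 x then insert x (r (A.erase x)) else r (A.erase x) := by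
  have hmem : ∀ A ∈ 𝒜, A.erase x ∈ 𝒜.image (·.erase x) := fun A hA => mem_image_of_mem _ hA
  have hxr : ∀ A ∈ 𝒜, x ∉ r (A.erase x) := fun A hA hx' =>
    notMem_erase x Y (hr.subset _ (hmem A hA) hx')
  set r' : Finset α → Finset α := fun A =>
    if x ∈ A ∧ A.erase x ∈ reduction 𝒜 x then insert x (r (A.erase x)) else r (A.erase x) with hr'
  have hsub : ∀ A, r (A.erase x) ⊆ r' A := by
    intro A
    simp only [hr']
    split_ifs
    · exact subset_insert _ _
    · exact Subset.rfl
  have herase : ∀ A ∈ 𝒜, (r' A).erase x = r (A.erase x) := by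
    intro A hA
    simp only [hr']
    split_ifs
    · exact erase_insert (hxr A hA)
    · exact erase_eq_of_notMem (hxr A hA)
  have hfiber : ∀ A ∈ 𝒜, ∀ A' ∈ 𝒜, A ≠ A' → A.erase x = A'.erase x →
      ((x ∈ A ∧ x ∉ A' ∧ x ∈ r' A ∧ x ∉ r' A') ∨ (x ∈ A' ∧ x ∉ A ∧ x ∈ r' A' ∧ x ∉ r' A)) := by
    have key : ∀ A ∈ 𝒜, ∀ A' ∈ 𝒜, A.erase x = A'.erase x → x ∈ A → x ∉ A' →
        x ∈ r' A ∧ x ∉ r' A' := by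
      intro A hA A' hA' heq h1 h2
      have hred' : A.erase x ∈ reduction 𝒜 x := by
        refine mem_reduction.2 ⟨by rwa [insert_erase h1], ?_, notMem_erase x A⟩
        rwa [heq, erase_eq_of_notMem h2]
      constructor
      · simp only [hr', if_pos (And.intro h1 hred'), mem_insert_self]
      · simp only [hr', h2, false_and, if_false]
        exact hxr A' hA'
    intro A hA A' hA' hne heq
    by_cases h1 : x ∈ A <;> by_cases h2 : x ∈ A'
    · exact absurd (by rw [← insert_erase h1, heq, insert_erase h2]) hne
    · exact Or.inl ⟨h1, h2, key A hA A' hA' heq h1 h2⟩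
    · exact Or.inr ⟨h2, h1, key A' hA' A hA heq.symm h2 h1⟩
    · exact absurd (by rw [← erase_eq_of_notMem h1, heq, erase_eq_of_notMem h2]) hne
  refine ⟨fun A hA => ?_, fun A hA => ?_, fun A hA A' hA' heq => ?_, fun A hA A' hA' hne heq => ?_⟩
  · have := (hr.subset _ (hmem A hA)).trans (erase_subset x Y)
    simp only [hr']
    split_ifs
    · exact insert_subset hx this
    · exact this
  · simp only [hr']
    split_ifs with h
    · exact (card_insert_le _ _).trans (Nat.succ_le_succ (hred _ h.2))
    · exact hr.card_le _ (hmem A hA)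
  · by_contra hne
    have h1 := hr.injOn _ (hmem A hA) _ (hmem A' hA')
      (by rw [← herase A hA, ← herase A' hA', heq])
    have := hfiber A hA A' hA' hne h1
    rw [heq] at this
    tauto
  · by_cases h1 : A.erase x = A'.erase x
    · have h2 := hfiber A hA A' hA' hne h1
      have h3 := Finset.ext_iff.1 heq x
      simp only [mem_inter, mem_union] at h3
      tauto
    · refine hr.ne_inter _ (hmem A hA) _ (hmem A' hA') h1 ?_
      ext j
      have h3 := Finset.ext_iff.1 heq j
      have h4 := @hsub A j
      have h5 := @hsub A' j
      simp only [mem_inter, mem_union, mem_erase] at h3 ⊢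
      tauto

theorem MaximumOn.exists_isRepresentation {Y : Finset α} {d : ℕ} {𝒜 : Finset (Finset α)}
    (h : MaximumOn Y d 𝒜) : ∃ r, IsRepresentation Y d 𝒜 r := by
  induction Y using Finset.induction_on generalizing d 𝒜 with
  | empty =>
    refine ⟨_, isRepresentation_empty ?_⟩
    rw [h.card_eq, sum_range_succ']
    simp
  | insert x Y hx ih =>
    cases d with
    | zero => exact ⟨_, isRepresentation_empty h.card_eq_one⟩
    | succ d =>
      obtain ⟨h1, h2⟩ := h.card_image_erase_and_reduction (mem_insert_self x Y)
      obtain ⟨r, hr⟩ := ih (by rwa [erase_insert hx] at h2)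
      rw [← erase_insert hx] at hr
      obtain ⟨r', hr', hred⟩ := h1.exists_extension h2 (reduction_subset_image_erase 𝒜 x) hr
      exact ⟨_, hr'.lift (mem_insert_self x Y) hred⟩

theorem IsRepresentation.exists_eq {Y : Finset α} {d : ℕ} {𝒜 : Finset (Finset α)}
    {r : Finset α → Finset α} (hr : IsRepresentation Y d 𝒜 r) (h : MaximumOn Y d 𝒜)
    {I : Finset α} (hI : I ⊆ Y) (hc : #I ≤ d) : ∃ A ∈ 𝒜, r A = I := by
  have hmem : ∀ {J : Finset α}, J ∈ ((range (d + 1)).biUnion fun i => powersetCard i Y) ↔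
      #J ≤ d ∧ J ⊆ Y := by
    intro J
    simp [mem_powersetCard, and_comm]
  obtain ⟨A, hA, hAI⟩ := surj_on_of_inj_on_of_card_le (s := 𝒜) (fun A _ => r A)
    (fun A hA => hmem.2 ⟨hr.card_le A hA, hr.subset A hA⟩)
    (fun A A' hA hA' heq => hr.injOn A hA A' hA' heq)
    (by rw [card_biUnion_powersetCard, h.card_eq]) I (hmem.2 ⟨hc, hI⟩)
  exact ⟨A, hA, hAI.symm⟩

end SetFamily

/-- The set of coordinates on which `c` is true. -/
def trueSet {n : ℕ} (c : Fin n → Bool) : Finset (Fin n) := univ.filter fun i => c i = true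

theorem mem_trueSet {n : ℕ} {c : Fin n → Bool} {i : Fin n} : i ∈ trueSet c ↔ c i = true := by
  simp [trueSet]

theorem trueSet_injective {n : ℕ} : Function.Injective (trueSet (n := n)) := by
  intro c c' h
  funext i
  rw [Bool.eq_iff_iff, ← mem_trueSet, ← mem_trueSet, h]

theorem IsMaximum.maximumOn {n d : ℕ} {C : Finset (Fin n → Bool)} (hC : IsMaximum C d) :
    MaximumOn univ d (C.image trueSet) := by
  refine ⟨fun A _ => subset_univ A, fun S hS => hC.1.2 S fun p => ?_, ?_⟩
  · obtain ⟨u, hu, hSu⟩ := hS (t := S ∩ trueSet p) inter_subset_left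
    obtain ⟨c, hc, rfl⟩ := mem_image.1 hu
    refine ⟨c, hc, fun i hi => ?_⟩
    have := Finset.ext_iff.1 hSu i
    simpa [hi, mem_trueSet, ← Bool.eq_iff_iff] using this
  · rw [card_image_of_injective _ trueSet_injective, hC.2, card_univ, Fintype.card_fin]

/-- Every `d`-maximum class `C ⊆ {0,1}^n` with `1 ≤ d ≤ n` admits an
unlabeled compression scheme of size `d`: a bijection `r` between `C` and the subsets of
coordinates of cardinality at most `d` such that distinct concepts differ on the union of
their representatives. -/
theorem stmt2 (n d : ℕ) (hd : 1 ≤ d) (hdn : d ≤ n)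
    (C : Finset (Fin n → Bool)) (hC : IsMaximum C d) :
    ∃ r : (Fin n → Bool) → Finset (Fin n),
      (∀ c ∈ C, (r c).card ≤ d) ∧
      (∀ c ∈ C, ∀ c' ∈ C, r c = r c' → c = c') ∧
      (∀ I : Finset (Fin n), I.card ≤ d → ∃ c ∈ C, r c = I) ∧
      (∀ c ∈ C, ∀ c' ∈ C, c ≠ c' → ∃ i ∈ r c ∪ r c', c i ≠ c' i) := by
  have hmax := hC.maximumOn
  obtain ⟨r, hr⟩ := hmax.exists_isRepresentation
  have hmem : ∀ c ∈ C, trueSet c ∈ C.image trueSet := fun c hc => mem_image_of_mem _ hc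
  refine ⟨fun c => r (trueSet c), fun c hc => hr.card_le _ (hmem c hc),
    fun c hc c' hc' h => trueSet_injective (hr.injOn _ (hmem c hc) _ (hmem c' hc') h),
    fun I hI => ?_, fun c hc c' hc' hne => ?_⟩
  · obtain ⟨A, hA, hAI⟩ := hr.exists_eq hmax (subset_univ I) hI
    obtain ⟨c, hc, rfl⟩ := mem_image.1 hA
    exact ⟨c, hc, hAI⟩
  · by_contra! hcon
    refine hr.ne_inter _ (hmem c hc) _ (hmem c' hc') (trueSet_injective.ne hne) ?_
    ext i
    simp only [mem_inter, mem_trueSet]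
    exact and_congr_left fun hi => by rw [hcon i hi]

end GeomCompress
end

section
/- If C ⊆ {0,1}^n is shortest-path closed and v ∈ C is a corner vertex of C — i.e., there is a unique cube of maximum dimension among all cubes of C containing v, and every neighbor of v in the one-inclusion graph of C lies in that cube — then C \ {v} is shortest-path closed. -/
open Finset

namespace GeomCompress

theorem hamming_eq_hammingDist {n : ℕ} (u v : Fin n → Bool) : hamming u v = hammingDist u v := by
  simp [hamming, hammingDist]

/-- A walk of length `m` joins concepts at Hamming distance at most `m`. -/
theorem hamming_le_of_adj {n L : ℕ} {p : ℕ → Fin n → Bool}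
    (hp : ∀ k < L, Adj (p k) (p (k + 1))) (a m : ℕ) (h : a + m ≤ L) :
    hamming (p a) (p (a + m)) ≤ m := by
  induction m with
  | zero => simp [hamming]
  | succ m ih =>
    have h1 := ih (by omega)
    have h2 : hamming (p (a + m)) (p (a + m + 1)) = 1 := hp (a + m) (by omega)
    have h3 := hammingDist_triangle (p a) (p (a + m)) (p (a + m + 1))
    simp only [hamming_eq_hammingDist, ← add_assoc] at *
    omega

/-- A walk realizing the Hamming distance of its ends visits no concept twice. -/
theorem ne_of_adj_of_lt {n L : ℕ} {p : ℕ → Fin n → Bool}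
    (hp : ∀ k < L, Adj (p k) (p (k + 1))) (hL : hamming (p 0) (p L) = L)
    {a b : ℕ} (hab : a < b) (hb : b ≤ L) : p a ≠ p b := by
  intro h
  have h1 := hamming_le_of_adj hp 0 a (by omega)
  have h2 := hamming_le_of_adj hp b (L - b) (by omega)
  have h3 := hammingDist_triangle (p 0) (p a) (p L)
  rw [zero_add] at h1
  rw [← h, show b + (L - b) = L by omega] at h2
  simp only [hamming_eq_hammingDist] at *
  omega

/-- A concept agreeing outside `I` with a member of a cube colored by `I` lies in the cube. -/
theorem IsCube.mem_of_eq_off {n : ℕ} {C Q : Finset (Fin n → Bool)} {I : Finset (Fin n)}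
    (hQ : IsCube C Q I) {v w : Fin n → Bool} (hv : v ∈ Q) (h : ∀ i ∉ I, w i = v i) :
    w ∈ Q := by
  obtain ⟨u, hu, hui⟩ := hQ.2.2 w
  have : u = w := by
    funext i
    by_cases hi : i ∈ I
    · exact hui i hi
    · rw [h i hi, hQ.2.1 u hu v hv i hi]
  exact this ▸ hu

/-- If `C ⊆ {0,1}^n` is shortest-path closed and `v ∈ C` is a corner
vertex of `C`, then `C \ {v}` is shortest-path closed. -/
theorem stmt3 (n : ℕ) (C : Finset (Fin n → Bool)) (hC : SPClosed C)
    (v : Fin n → Bool) (hv : v ∈ C) (hcorner : IsCorner C v) :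
    SPClosed (C.erase v) := by
  obtain ⟨Q, I, hQ, hvQ, -, -, hN⟩ := hcorner
  intro a ha b hb
  obtain ⟨hav, haC⟩ := Finset.mem_erase.mp ha
  obtain ⟨hbv, hbC⟩ := Finset.mem_erase.mp hb
  obtain ⟨p, hp0, hpL, hpC, hpA⟩ := hC a haC b hbC
  generalize hL : hamming a b = L at *
  by_cases hex : ∃ k ≤ L, p k = v
  · obtain ⟨k, hkL, hk⟩ := hex
    have hk0 : k ≠ 0 := by rintro rfl; exact hav (hp0.symm.trans hk)
    have hkL' : k ≠ L := by rintro rfl; exact hbv (hpL.symm.trans hk)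
    obtain ⟨j, rfl⟩ := Nat.exists_eq_succ_of_ne_zero hk0
    simp only [Nat.succ_eq_add_one] at *
    have hne : ∀ {s t : ℕ}, s < t → t ≤ L → p s ≠ p t :=
      ne_of_adj_of_lt hpA (by rw [hp0, hpL, hL])
    have hxv : Adj (p j) v := hk ▸ hpA j (by omega)
    have hvy : Adj v (p (j + 2)) := hk ▸ hpA (j + 1) (by omega)
    have hyv : Adj (p (j + 2)) v := by
      simpa only [Adj, hamming, ne_comm] using hvy
    have hxQ := hN _ (hpC j (by omega)) hxv
    have hyQ := hN _ (hpC (j + 2) (by omega)) hyv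
    have hxy : p j ≠ p (j + 2) := hne (by omega) (by omega)
    -- the fourth vertex of the square spanned by `v` and its two neighbors on the walk
    let w : Fin n → Bool := fun i => xor (xor (p j i) (p (j + 2) i)) (v i)
    have hwQ : w ∈ Q := hQ.mem_of_eq_off hvQ fun i hi => by
      simp [w, hQ.2.1 _ hxQ _ hvQ i hi, hQ.2.1 _ hyQ _ hvQ i hi]
    have hwv : w ≠ v := fun h => hxy <| funext fun i => by
      have := congrFun h i
      revert this
      cases h1 : p j i <;> cases h2 : p (j + 2) i <;> cases h3 : v i <;> simp [w, h1, h2, h3]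
    have hxw : Adj (p j) w := by
      refine Eq.trans ?_ hvy
      rw [hamming, hamming]
      congr 1
      ext i
      cases h1 : p j i <;> cases h2 : p (j + 2) i <;> cases h3 : v i <;> simp [w, h1, h2, h3]
    have hwy : Adj w (p (j + 2)) := by
      refine Eq.trans ?_ hxv
      rw [hamming, hamming]
      congr 1
      ext i
      cases h1 : p j i <;> cases h2 : p (j + 2) i <;> cases h3 : v i <;> simp [w, h1, h2, h3]
    refine ⟨Function.update p (j + 1) w, ?_, ?_, fun m hm => ?_, fun m hm => ?_⟩
    · rw [Function.update_of_ne (by omega), hp0]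
    · rw [Function.update_of_ne (by omega), hpL]
    · by_cases hmj : m = j + 1
      · subst hmj
        simpa using ⟨hwv, hQ.1 hwQ⟩
      · rw [Function.update_of_ne hmj]
        refine Finset.mem_erase.mpr ⟨?_, hpC m hm⟩
        rw [← hk]
        rcases lt_or_gt_of_ne hmj with h | h
        · exact hne h hkL
        · exact (hne h hm).symm
    · by_cases h1 : m = j
      · subst h1
        simpa using hxw
      · by_cases h2 : m = j + 1
        · subst h2
          simpa using hwy
        · rw [Function.update_of_ne h2, Function.update_of_ne (by omega)]
          exact hpA m hm
  · push Not at hex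
    exact ⟨p, hp0, hpL, fun k hk => Finset.mem_erase.mpr ⟨hex k hk, hpC k hk⟩, hpA⟩

end GeomCompress
end

section
/- Let C ⊆ {0,1}^n be a d-maximum class with 1 < d ≤ n. Then for every set I of d−1 coordinates, the boundary ∂C contains at least two distinct (d−1)-cubes colored by I. -/
open Finset

namespace GeomCompress

/-- Down-compressing along all elements of `J` yields a family of the same size, shattering no new
set, in which a member containing `J` witnesses a full `J`-cube of the original family. -/
lemma exists_compression {α : Type*} [DecidableEq α] (𝒜 : Finset (Finset α)) (J : Finset α) :
    ∃ ℬ : Finset (Finset α), ℬ.card = 𝒜.card ∧ ℬ.shatterer ⊆ 𝒜.shatterer ∧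
      ∀ u ∈ ℬ, J ⊆ u → ∀ t ⊆ J, (u \ J) ∪ t ∈ 𝒜 := by
  induction J using Finset.induction_on with
  | empty =>
    refine ⟨𝒜, rfl, subset_rfl, fun u hu _ t ht => ?_⟩
    simpa [subset_empty.1 ht] using hu
  | insert a J ha ih =>
    obtain ⟨ℬ, hcard, hsh, hcube⟩ := ih
    refine ⟨Down.compression a ℬ, by rw [Down.card_compression, hcard],
      (shatterer_compress_subset_shatterer a ℬ).trans hsh, fun u hu hJu t ht => ?_⟩
    rw [insert_subset_iff] at hJu
    have hu' : u ∈ ℬ ∧ u.erase a ∈ ℬ := by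
      rw [Down.mem_compression] at hu
      rcases hu with h | ⟨h1, h2⟩
      · exact h
      · rw [insert_eq_of_mem hJu.1] at h2
        exact absurd h2 h1
    by_cases hat : a ∈ t
    · have := hcube u hu'.1 hJu.2 (t.erase a) (by
        intro x hx
        have := ht (mem_of_mem_erase hx)
        grind)
      convert this using 1
      ext x
      have := hJu.1
      grind
    · have := hcube _ hu'.2 (fun x hx => mem_erase.2 ⟨by grind, hJu.2 hx⟩) t (by
        intro x hx
        have := ht hx
        grind)
      convert this using 1
      ext x
      grind

/-- A family attaining the Sauer-Shelah bound contains a cube in each set of `d` directions. -/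
lemma exists_cube_of_card_eq {α : Type*} [DecidableEq α] [Fintype α] {𝒜 : Finset (Finset α)}
    {d : ℕ} (hd : ∀ s, 𝒜.Shatters s → s.card ≤ d)
    (hcard : 𝒜.card = ∑ i ∈ range (d + 1), (Fintype.card α).choose i)
    {J : Finset α} (hJ : J.card = d) :
    ∃ u : Finset α, Disjoint u J ∧ ∀ t ⊆ J, u ∪ t ∈ 𝒜 := by
  obtain ⟨ℬ, hℬ, hsh, hcube⟩ := exists_compression 𝒜 J
  have hsub : ℬ.shatterer ⊆ (range (d + 1)).biUnion fun k => powersetCard k univ := by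
    intro s hs
    have := hd s (mem_shatterer.1 (hsh hs))
    simp only [mem_biUnion, mem_range, mem_powersetCard_univ]
    exact ⟨s.card, by omega, rfl⟩
  have hle : ((range (d + 1)).biUnion fun k => powersetCard k (univ : Finset α)).card ≤
      ℬ.shatterer.card := by
    refine card_biUnion_le.trans ?_
    simp only [card_powersetCard, card_univ]
    rw [← hcard, ← hℬ]
    exact card_le_card_shatterer ℬ
  have hmem : J ∈ ℬ.shatterer := by
    rw [eq_of_subset_of_card_le hsub hle]
    simp only [mem_biUnion, mem_range, mem_powersetCard_univ]
    exact ⟨d, by omega, hJ⟩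
  obtain ⟨u, hu, hJu⟩ := (mem_shatterer.1 hmem).exists_superset
  exact ⟨u \ J, sdiff_disjoint, hcube u hu hJu⟩

/-- In a family of sets in which each direction carries at most one edge, an edge from `∅` to `{i}`
leads to a leaf containing `i`. -/
lemma exists_leaf {α : Type*} [DecidableEq α] [Fintype α] {P : Finset α → Prop}
    (huniq : ∀ k p q, P p → P (symmDiff p {k}) → P q → P (symmDiff q {k}) →
      q = p ∨ q = symmDiff p {k})
    {i : α} (h0 : P ∅) (hi : P {i}) :
    ∃ v j, i ∈ v ∧ P v ∧ P (symmDiff v {j}) ∧ ∀ k, P (symmDiff v {k}) → k = j := by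
  classical
  let Inv : Finset α → α → Prop := fun v j => i ∈ v ∧ j ∈ v ∧ P v ∧ P (symmDiff v {j}) ∧
    ∀ k ∈ v, k ≠ j → ∃ q ⊆ v, j ∉ q ∧ P q ∧ P (symmDiff q {k})
  have hne : (univ.filter fun v => ∃ j, Inv v j).Nonempty :=
    ⟨{i}, mem_filter.2 ⟨mem_univ _, i, by simp, by simp, hi, by simpa using h0, by simp⟩⟩
  obtain ⟨v, hv, hmax⟩ := exists_max_image _ card hne
  obtain ⟨j, hiv, hjv, hPv, hPj, hpath⟩ := (mem_filter.1 hv).2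
  refine ⟨v, j, hiv, hPv, hPj, fun k hk => ?_⟩
  by_contra hkj
  by_cases hkv : k ∈ v
  · obtain ⟨q, -, hjq, hq, hqk⟩ := hpath k hkv hkj
    rcases huniq k v q hPv hk hq hqk with rfl | rfl
    · exact hjq hjv
    · exact hjq (by simp [mem_symmDiff, hjv, Ne.symm hkj])
  · have hins : symmDiff v {k} = insert k v := by
      ext x
      simp only [mem_symmDiff, mem_singleton, mem_insert]
      grind
    have hback : symmDiff (insert k v) {k} = v := by rw [← hins, symmDiff_symmDiff_cancel_right]
    have hInv : Inv (insert k v) k := by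
      refine ⟨mem_insert_of_mem hiv, mem_insert_self _ _, hins ▸ hk, hback.symm ▸ hPv,
        fun l hl hlk => ?_⟩
      by_cases hlj : l = j
      · subst hlj
        exact ⟨v, subset_insert _ _, hkv, hPv, hPj⟩
      · obtain ⟨q, hqv, -, hq, hql⟩ := hpath l ((mem_insert.1 hl).resolve_left hlk) hlj
        exact ⟨q, hqv.trans (subset_insert _ _), fun h => hkv (hqv h), hq, hql⟩
    have := hmax _ (mem_filter.2 ⟨mem_univ _, k, hInv⟩)
    rw [card_insert_of_notMem hkv] at this
    omega

/-- The vectors agreeing outside `I` with the indicator of `v`. -/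
def cubeAt {n : ℕ} (I v : Finset (Fin n)) : Finset (Fin n → Bool) :=
  univ.filter fun c => ∀ i, i ∉ I → (c i = true ↔ i ∈ v)

lemma mem_cubeAt {n : ℕ} {I v : Finset (Fin n)} {c : Fin n → Bool} :
    c ∈ cubeAt I v ↔ ∀ i, i ∉ I → (c i = true ↔ i ∈ v) := by
  simp [cubeAt]

lemma exists_mem_cubeAt {n : ℕ} (I v : Finset (Fin n)) (p : Fin n → Bool) :
    ∃ c ∈ cubeAt I v, (∀ i ∈ I, c i = p i) ∧ ∀ i, i ∉ I → c i = decide (i ∈ v) := by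
  refine ⟨fun i => if i ∈ I then p i else decide (i ∈ v), mem_cubeAt.2 fun i hi => ?_,
    fun i hi => ?_, fun i hi => ?_⟩ <;> simp [hi]

lemma isCube_cubeAt {n : ℕ} {C : Finset (Fin n → Bool)} {I v : Finset (Fin n)}
    (h : cubeAt I v ⊆ C) : IsCube C (cubeAt I v) I := by
  refine ⟨h, fun a ha b hb i hi => ?_, fun p => ?_⟩
  · rw [Bool.eq_iff_iff, mem_cubeAt.1 ha i hi, mem_cubeAt.1 hb i hi]
  · obtain ⟨c, hc, hp, -⟩ := exists_mem_cubeAt I v p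
    exact ⟨c, hc, hp⟩

lemma IsCube.eq_cubeAt {n : ℕ} {C Q : Finset (Fin n → Bool)} {I I₁ v : Finset (Fin n)}
    (hQ : IsCube C Q I₁) (hI : I ⊆ I₁) (hv : cubeAt I v ⊆ Q) : Q = cubeAt I₁ v := by
  obtain ⟨w, hw, -, hwv⟩ := exists_mem_cubeAt I v fun _ => false
  have hwQ := hv hw
  ext c
  rw [mem_cubeAt]
  refine ⟨fun hc i hi => ?_, fun hc => ?_⟩
  · rw [hQ.2.1 c hc w hwQ i hi, hwv i fun h => hi (hI h), decide_eq_true_iff]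
  · obtain ⟨u, hu, huc⟩ := hQ.2.2 c
    suffices c = u from this ▸ hu
    funext i
    by_cases hi : i ∈ I₁
    · exact (huc i hi).symm
    · rw [hQ.2.1 u hu w hwQ i hi, hwv i fun h => hi (hI h), Bool.eq_iff_iff, hc i hi,
        decide_eq_true_iff]

lemma cubeAt_insert {n : ℕ} (I v : Finset (Fin n)) (k : Fin n) :
    cubeAt (insert k I) v = cubeAt I v ∪ cubeAt I (symmDiff v {k}) := by
  ext c
  simp only [mem_union, mem_cubeAt, mem_symmDiff, mem_singleton]
  constructor
  · intro h
    by_cases hk : c k = true ↔ k ∈ v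
    · left
      grind
    · right
      grind
  · grind

/-- At most one pair of `I`-cubes of `C` is joined by an edge of direction `k`. -/
lemma eq_or_eq_symmDiff_of_cubeAt_subset {n : ℕ} {C : Finset (Fin n → Bool)}
    {I p q : Finset (Fin n)} {k : Fin n}
    (hC : ∀ Y, Shatters C Y → Y.card ≤ I.card + 1) (hkI : k ∉ I)
    (hpI : Disjoint p I) (hqI : Disjoint q I)
    (hp : cubeAt I p ⊆ C) (hpk : cubeAt I (symmDiff p {k}) ⊆ C)
    (hq : cubeAt I q ⊆ C) (hqk : cubeAt I (symmDiff q {k}) ⊆ C) :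
    q = p ∨ q = symmDiff p {k} := by
  by_contra hne
  obtain ⟨i, hik, hi⟩ : ∃ i, i ≠ k ∧ ¬ (i ∈ p ↔ i ∈ q) := by
    by_contra hall
    push Not at hall
    apply hne
    by_cases hk : k ∈ p ↔ k ∈ q
    · left
      ext x
      by_cases hx : x = k
      · rw [hx, hk]
      · exact (hall x hx).symm
    · right
      ext x
      have := hall x
      simp only [mem_symmDiff, mem_singleton]
      grind
  have hiI : i ∉ I := fun h => by
    have h1 := disjoint_right.1 hpI h
    have h2 := disjoint_right.1 hqI h
    exact hi (iff_of_false h1 h2)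
  have hsh : Shatters C (insert i (insert k I)) := by
    intro π
    obtain ⟨w, hw, hwi⟩ : ∃ w, cubeAt (insert k I) w ⊆ C ∧ (i ∈ w ↔ π i = true) := by
      by_cases h : i ∈ p ↔ π i = true
      · exact ⟨p, by rw [cubeAt_insert]; exact union_subset hp hpk, h⟩
      · exact ⟨q, by rw [cubeAt_insert]; exact union_subset hq hqk, by tauto⟩
    obtain ⟨c, hc, hcI, hcw⟩ := exists_mem_cubeAt (insert k I) w π
    refine ⟨c, hw hc, fun x hx => ?_⟩
    rcases mem_insert.1 hx with rfl | hx
    · rw [hcw x (by simp [hik, hiI]), Bool.eq_iff_iff, decide_eq_true_iff, hwi]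
    · exact hcI x hx
  have := hC _ hsh
  rw [card_insert_of_notMem (by simp [hik, hiI]), card_insert_of_notMem hkI] at this
  omega

/-- A `d`-maximum class contains a `d`-cube in each set of `d` directions. -/
lemma IsMaximum.exists_cubeAt_subset {n d : ℕ} {C : Finset (Fin n → Bool)} (hC : IsMaximum C d)
    {J : Finset (Fin n)} (hJ : J.card = d) : ∃ u, Disjoint u J ∧ cubeAt J u ⊆ C := by
  let F : (Fin n → Bool) → Finset (Fin n) := fun c => univ.filter fun i => c i = true
  have hmem : ∀ c i, i ∈ F c ↔ c i = true := fun c i => by simp [F]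
  have hF : Function.Injective F := fun a b hab => by
    funext i
    rw [Bool.eq_iff_iff, ← hmem, ← hmem, hab]
  obtain ⟨u, hu, hcube⟩ := exists_cube_of_card_eq (𝒜 := C.image F) (d := d) (fun s hs => by
      refine hC.1.2 s fun p => ?_
      obtain ⟨t, ht, hst⟩ := hs (t := s.filter fun i => p i = true) (filter_subset _ _)
      obtain ⟨c, hc, rfl⟩ := mem_image.1 ht
      refine ⟨c, hc, fun i hi => ?_⟩
      have := Finset.ext_iff.1 hst i
      simp only [mem_inter, mem_filter, hi, true_and, hmem] at this
      exact Bool.eq_iff_iff.2 this)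
    (by rw [card_image_of_injective _ hF, hC.2, Fintype.card_fin]) hJ
  refine ⟨u, hu, fun c hc => ?_⟩
  have h := hcube (J.filter fun i => c i = true) (filter_subset _ _)
  have : u ∪ J.filter (fun i => c i = true) = F c := by
    ext i
    have h1 := mem_cubeAt.1 hc i
    have h2 : i ∈ J → i ∉ u := fun h => disjoint_right.1 hu h
    simp only [mem_union, mem_filter, F, mem_univ, true_and]
    tauto
  rw [this, mem_image] at h
  obtain ⟨c', hc', h⟩ := h
  exact hF h ▸ hc'

/-- A leaf of the tree of `I`-colored cubes is a boundary cube. -/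
lemma isBoundaryCube_cubeAt {n d : ℕ} (hd : 1 < d) {C : Finset (Fin n → Bool)}
    {I v : Finset (Fin n)} (hI : I.card = d - 1) {j : Fin n} (hj : j ∉ I)
    (hv : cubeAt I v ⊆ C) (hvj : cubeAt I (symmDiff v {j}) ⊆ C)
    (hleaf : ∀ k, k ∉ I → cubeAt I (symmDiff v {k}) ⊆ C → k = j) :
    IsBoundaryCube C d (cubeAt I v) I := by
  have key : ∀ Q₁ I₁, IsCube C Q₁ I₁ → I₁.card = d → cubeAt I v ⊆ Q₁ → I ⊆ I₁ →
      Q₁ = cubeAt (insert j I) v := by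
    intro Q₁ I₁ hQ hcard hsub hI₁
    obtain ⟨k, hk⟩ : ∃ k, I₁ \ I = {k} := by
      rw [← card_eq_one, card_sdiff_of_subset hI₁]
      omega
    have hkI : k ∈ I₁ \ I := by simp [hk]
    have hI₁' : I₁ = insert k I := by
      rw [← union_sdiff_of_subset hI₁, hk, union_comm, insert_eq]
    have hQ' := hQ.eq_cubeAt hI₁ hsub
    have := hQ.1
    rw [hQ', hI₁', cubeAt_insert] at this
    rw [hQ', hI₁', hleaf k (mem_sdiff.1 hkI).2 (subset_union_right.trans this)]
  refine ⟨isCube_cubeAt hv, hI, ⟨cubeAt (insert j I) v, insert j I, isCube_cubeAt ?_, ?_, ?_,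
    subset_insert _ _⟩, fun Q₁ I₁ Q₂ I₂ h1 c1 s1 i1 h2 c2 s2 i2 => ?_⟩
  · rw [cubeAt_insert]
    exact union_subset hv hvj
  · rw [card_insert_of_notMem hj]
    omega
  · rw [cubeAt_insert]
    exact subset_union_left
  · rw [key Q₁ I₁ h1 c1 s1 i1, key Q₂ I₂ h2 c2 s2 i2]

/-- Each side of an edge of direction `i` contains a boundary cube. -/
lemma exists_isBoundaryCube {n d : ℕ} (hd : 1 < d) {C : Finset (Fin n → Bool)}
    (hC : ∀ Y, Shatters C Y → Y.card ≤ d) {I u : Finset (Fin n)} (hI : I.card = d - 1)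
    {i : Fin n} (hi : i ∉ I) (hu : Disjoint u I) (hcu : cubeAt I u ⊆ C)
    (hcui : cubeAt I (symmDiff u {i}) ⊆ C) :
    ∃ v, ¬ (i ∈ v ↔ i ∈ u) ∧ IsBoundaryCube C d (cubeAt I v) I := by
  have hdisj : ∀ {a b : Finset (Fin n)}, Disjoint a I → Disjoint b I → Disjoint (symmDiff a b) I :=
    fun ha hb => (disjoint_union_left.2 ⟨ha, hb⟩).mono_left symmDiff_le_sup
  have hsingle : ∀ {k}, k ∉ I → Disjoint ({k} : Finset (Fin n)) I := disjoint_singleton_left.2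
  have hcomm : ∀ a b : Finset (Fin n), symmDiff (symmDiff a b) u = symmDiff (symmDiff a u) b :=
    fun a b => symmDiff_right_comm a b u
  obtain ⟨v, j, hiv, ⟨hvI, hv⟩, ⟨hvjI, hvj⟩, hleaf⟩ := exists_leaf
    (P := fun w => Disjoint w I ∧ cubeAt I (symmDiff w u) ⊆ C) (i := i) (fun k p q hp hpk hq hqk => by
      have hkI : k ∉ I := fun hk => by
        have h1 := disjoint_right.1 hp.1 hk
        have h2 := disjoint_right.1 hpk.1 hk
        simp [mem_symmDiff, h1] at h2
      have h1 := hpk.2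
      have h2 := hqk.2
      rw [hcomm] at h1 h2
      have := eq_or_eq_symmDiff_of_cubeAt_subset (fun Y hY => (hC Y hY).trans (by omega)) hkI
        (hdisj hp.1 hu) (hdisj hq.1 hu) hp.2 h1 hq.2 h2
      rw [← hcomm] at this
      exact this.imp (fun h => symmDiff_left_injective u h) fun h => symmDiff_left_injective u h)
    ⟨disjoint_empty_left _, by simpa [← bot_eq_empty] using hcu⟩
    ⟨hsingle hi, by rwa [symmDiff_comm]⟩
  have hjI : j ∉ I := fun hj => by
    have h1 := disjoint_right.1 hvI hj
    have h2 := disjoint_right.1 hvjI hj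
    simp [mem_symmDiff, h1] at h2
  rw [hcomm] at hvj
  refine ⟨symmDiff v u, by simp only [mem_symmDiff]; tauto,
    isBoundaryCube_cubeAt hd hI hjI hv hvj fun k hk h => hleaf k ⟨hdisj hvI (hsingle hk), ?_⟩⟩
  rwa [hcomm]

/-- Let `C ⊆ {0,1}^n` be `d`-maximum with `1 < d ≤ n`. For every set `I`
of `d - 1` coordinates, the boundary `∂C` contains at least two distinct `(d-1)`-cubes
colored by `I`. -/
theorem stmt5 (n d : ℕ) (hd : 1 < d) (hdn : d ≤ n)
    (C : Finset (Fin n → Bool)) (hC : IsMaximum C d)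
    (I : Finset (Fin n)) (hI : I.card = d - 1) :
    ∃ Q1 Q2 : Finset (Fin n → Bool), Q1 ≠ Q2 ∧
      IsBoundaryCube C d Q1 I ∧ IsBoundaryCube C d Q2 I := by
  obtain ⟨i, hi⟩ : ∃ i, i ∉ I := by
    by_contra! h
    rw [eq_univ_iff_forall.2 h, card_univ, Fintype.card_fin] at hI
    omega
  obtain ⟨u, hu, hcube⟩ := hC.exists_cubeAt_subset (J := insert i I) (by
    rw [card_insert_of_notMem hi]
    omega)
  rw [cubeAt_insert] at hcube
  have hcu := subset_union_left.trans hcube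
  have hcui := subset_union_right.trans hcube
  have huI : Disjoint u I := hu.mono_right (subset_insert _ _)
  have huiI : Disjoint (symmDiff u {i}) I :=
    (disjoint_union_left.2 ⟨huI, disjoint_singleton_left.2 hi⟩).mono_left symmDiff_le_sup
  obtain ⟨v, hv, hbv⟩ := exists_isBoundaryCube hd hC.1.2 hI hi huI hcu hcui
  obtain ⟨w, hw, hbw⟩ := exists_isBoundaryCube hd hC.1.2 hI hi huiI hcui
    (by rwa [symmDiff_symmDiff_cancel_right])
  refine ⟨_, _, fun h => ?_, hbv, hbw⟩
  obtain ⟨c, hc, -⟩ := exists_mem_cubeAt I v fun _ => false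
  have h1 := mem_cubeAt.1 hc i hi
  have h2 := mem_cubeAt.1 (h ▸ hc) i hi
  simp only [mem_symmDiff, mem_singleton] at hw
  tauto

end GeomCompress
end

section
/- The concept class C ⊆ {0,1}^n induced by a simple linear arrangement of n hyperplanes in ℝ^d (n ≥ d ≥ 1) is d-maximum. -/
open Finset

namespace GeomCompress

/-- A class that contains a cube with color set `S` for every `S` of size at most `d`, and that
shatters no set of more than `d` coordinates, has the Sauer-Shelah cardinality. -/
theorem card_eq_sum_choose {n d : ℕ} {C : Finset (Fin n → Bool)}
    (hcube : ∀ S : Finset (Fin n), S.card ≤ d →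
      ∃ q : Fin n → Bool, ∀ p : Fin n → Bool, (∀ i, i ∉ S → p i = q i) → p ∈ C)
    (hshat : ∀ Y : Finset (Fin n), Shatters C Y → Y.card ≤ d) :
    C.card = ∑ i ∈ Finset.range (d + 1), Nat.choose n i := by
  let 𝒜 : Finset (Finset (Fin n)) := univ.filter fun s => (fun i => decide (i ∈ s)) ∈ C
  let 𝒟 : Finset (Finset (Fin n)) := univ.filter fun s => s.card ≤ d
  have h𝒜 : C.card = 𝒜.card := by
    refine Finset.card_nbij' (fun c => univ.filter fun i => c i = true)
      (fun s i => decide (i ∈ s)) ?_ ?_ ?_ ?_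
    · intro c hc
      simpa [𝒜] using hc
    · intro s hs
      simpa [𝒜] using hs
    · intro c _
      simp
    · intro s _
      simp
  have h𝒟 : 𝒟.card = ∑ i ∈ Finset.range (d + 1), Nat.choose n i := by
    have hmaps : ∀ s ∈ 𝒟, s.card ∈ Finset.range (d + 1) := by
      intro s hs
      simp only [𝒟, mem_filter, mem_univ, true_and] at hs
      simpa using Nat.lt_succ_of_le hs
    rw [card_eq_sum_card_fiberwise hmaps]
    refine sum_congr rfl fun k hk => ?_
    have hfiber : (𝒟.filter fun s => s.card = k) = powersetCard k univ := by
      ext s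
      simp only [𝒟, mem_filter, mem_univ, true_and, mem_powersetCard_univ, mem_range] at hk ⊢
      omega
    rw [hfiber, card_powersetCard, card_univ, Fintype.card_fin]
  have hupper : 𝒜.shatterer ⊆ 𝒟 := by
    intro Y hY
    rw [mem_shatterer] at hY
    simp only [𝒟, mem_filter, mem_univ, true_and]
    refine hshat Y fun p => ?_
    obtain ⟨u, hu, huY⟩ := hY (filter_subset (fun i => p i = true) Y)
    refine ⟨_, (mem_filter.1 hu).2, fun i hi => ?_⟩
    have := Finset.ext_iff.1 huY i
    simp only [mem_inter, mem_filter, hi, true_and] at this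
    rw [Bool.eq_iff_iff]
    simpa using this
  have hlower : 𝒜ᶜ.shatterer ⊆ (𝒟.image compl)ᶜ := by
    intro Y hY
    rw [mem_shatterer] at hY
    rw [mem_compl, mem_image]
    rintro ⟨S, hS, rfl⟩
    obtain ⟨q, hq⟩ := hcube S (mem_filter.1 hS).2
    obtain ⟨u, hu, huS⟩ := hY (filter_subset (fun i => q i = true) Sᶜ)
    refine mem_compl.1 hu (mem_filter.2 ⟨mem_univ _, hq _ fun i hi => ?_⟩)
    have := Finset.ext_iff.1 huS i
    simp only [mem_inter, mem_filter, mem_compl, hi, not_false_eq_true, true_and] at this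
    rw [Bool.eq_iff_iff]
    simpa using this
  have h1 := (card_le_card_shatterer 𝒜).trans (card_le_card hupper)
  have h2 := (card_le_card_shatterer 𝒜ᶜ).trans (card_le_card hlower)
  rw [card_compl, card_compl, card_image_of_injective _ compl_injective] at h2
  have h3 := card_le_univ 𝒜
  have h4 := card_le_univ 𝒟
  omega

theorem dotR_add_smul {d : ℕ} (u x v : Fin d → ℝ) (t : ℝ) :
    dotR u (x + t • v) = dotR u x + t * dotR u v := by
  simp only [dotR, Pi.add_apply, Pi.smul_apply, smul_eq_mul, mul_add, sum_add_distrib, mul_sum]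
  congr 1
  exact sum_congr rfl fun i _ => by ring

/-- Linear functionals with independent normals attain arbitrary prescribed values. -/
theorem exists_dotR_eq {d n : ℕ} {a : Fin n → Fin d → ℝ} {S : Finset (Fin n)}
    (h : LinearIndependent ℝ (fun i : S => a i.1)) (y : Fin n → ℝ) :
    ∃ x : Fin d → ℝ, ∀ i ∈ S, dotR (a i) x = y i := by
  let M : Matrix S (Fin d) ℝ := Matrix.of fun i => a i.1
  have hrank : M.rank = Fintype.card S := LinearIndependent.rank_matrix h
  have htop : LinearMap.range M.mulVecLin = ⊤ := by
    apply Submodule.eq_top_of_finrank_eq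
    rw [Module.finrank_fintype_fun_eq_card]
    exact hrank
  obtain ⟨x, hx⟩ := LinearMap.range_eq_top.1 htop fun i => y i.1
  exact ⟨x, fun i hi => congrFun hx ⟨i, hi⟩⟩

/-- A value different from `c` stays different from `c` under small perturbations. -/
theorem eventually_dotR_ne {d : ℕ} {u x : Fin d → ℝ} {c : ℝ} (h : dotR u x ≠ c)
    (v : Fin d → ℝ) :
    ∀ᶠ t : ℝ in nhdsWithin 0 (Set.Ioi 0),
      dotR u (x + t • v) ≠ c ∧ (c < dotR u (x + t • v) ↔ c < dotR u x) := by
  have hcont : Filter.Tendsto (fun t : ℝ => dotR u (x + t • v)) (nhdsWithin 0 (Set.Ioi 0))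
      (nhds (dotR u x)) := by
    simp only [dotR_add_smul]
    have : Continuous fun t : ℝ => dotR u x + t * dotR u v := by fun_prop
    simpa using (this.tendsto 0).mono_left nhdsWithin_le_nhds
  rcases lt_or_gt_of_ne h with h | h
  · filter_upwards [hcont.eventually_lt_const h] with t ht
    exact ⟨ht.ne, iff_of_false ht.not_gt h.not_gt⟩
  · filter_upwards [hcont.eventually_const_lt h] with t ht
    exact ⟨ht.ne', iff_of_true ht h⟩

/-- The intersection of at most `d` hyperplanes of a simple arrangement contains a point lying
on none of the other hyperplanes. -/
theorem SimpleArrangement.exists_mem_flat {d n : ℕ} {a : Fin n → Fin d → ℝ} {b : Fin n → ℝ}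
    (hA : SimpleArrangement d a b) {S : Finset (Fin n)} (hS : S.card ≤ d) :
    ∃ x : Fin d → ℝ, (∀ i ∈ S, dotR (a i) x = b i) ∧ ∀ j, j ∉ S → dotR (a j) x ≠ b j := by
  have hsingle : ∀ j, j ∉ S →
      ∃ x : Fin d → ℝ, (∀ i ∈ S, dotR (a i) x = b i) ∧ dotR (a j) x ≠ b j := by
    intro j hj
    have hcard := card_insert_of_notMem hj
    rcases hS.lt_or_eq with hlt | heq
    · obtain ⟨x, hx⟩ := exists_dotR_eq (hA.1 (insert j S) (by omega))
        (fun i => if i = j then b j + 1 else b i)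
      refine ⟨x, fun i hi => ?_, ?_⟩
      · rw [hx i (mem_insert_of_mem hi), if_neg (ne_of_mem_of_not_mem hi hj)]
      · rw [hx j (mem_insert_self j S), if_pos rfl]
        simp
    · obtain ⟨x, hx⟩ := exists_dotR_eq (hA.1 S hS) b
      refine ⟨x, hx, fun hxj => hA.2 (insert j S) (by omega) ⟨x, fun i hi => ?_⟩⟩
      rcases mem_insert.1 hi with rfl | hi
      exacts [hxj, hx i hi]
  suffices H : ∀ J : Finset (Fin n), ∃ x : Fin d → ℝ,
      (∀ i ∈ S, dotR (a i) x = b i) ∧ ∀ j ∈ J, j ∉ S → dotR (a j) x ≠ b j by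
    obtain ⟨x, hx, hxJ⟩ := H univ
    exact ⟨x, hx, fun j => hxJ j (mem_univ j)⟩
  intro J
  induction J using Finset.induction_on with
  | empty =>
    obtain ⟨x, hx⟩ := exists_dotR_eq (hA.1 S hS) b
    exact ⟨x, hx, by simp⟩
  | insert j J _ ih =>
    obtain ⟨x, hx, hxJ⟩ := ih
    by_cases hgood : j ∈ S ∨ dotR (a j) x ≠ b j
    · refine ⟨x, hx, fun k hk hkS => ?_⟩
      rcases mem_insert.1 hk with rfl | hk
      exacts [hgood.resolve_left hkS, hxJ k hk hkS]
    push Not at hgood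
    obtain ⟨y, hy, hyj⟩ := hsingle j hgood.1
    have hdir : ∀ i, dotR (a i) (y - x) = dotR (a i) y - dotR (a i) x := fun i => by
      simp [dotR, mul_sub]
    have hev : ∀ᶠ t : ℝ in nhdsWithin 0 (Set.Ioi 0),
        ∀ k ∈ J, k ∉ S → dotR (a k) (x + t • (y - x)) ≠ b k := by
      rw [Filter.eventually_all_finset]
      intro k hk
      by_cases hkS : k ∈ S
      · simp [hkS]
      · filter_upwards [eventually_dotR_ne (hxJ k hk hkS) (y - x)] with t ht _
        exact ht.1
    obtain ⟨t, ht, htpos⟩ := (hev.and self_mem_nhdsWithin).exists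
    refine ⟨x + t • (y - x), fun i hi => ?_, fun k hk hkS => ?_⟩
    · rw [dotR_add_smul, hdir, hx i hi, hy i hi]
      ring
    · rcases mem_insert.1 hk with rfl | hk
      · rw [dotR_add_smul, hdir, hgood.2]
        have := mul_ne_zero (ne_of_gt htpos) (sub_ne_zero.2 hyj)
        simpa using this
      · exact ht k hk hkS

/-- The class induced by a simple arrangement contains a cube of every color set of size at
most `d`. -/
theorem SimpleArrangement.exists_cube {d n : ℕ} {a : Fin n → Fin d → ℝ} {b : Fin n → ℝ}
    (hA : SimpleArrangement d a b) {C : Finset (Fin n → Bool)} (hC : IsInducedClass a b C)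
    (S : Finset (Fin n)) (hS : S.card ≤ d) :
    ∃ q : Fin n → Bool, ∀ p : Fin n → Bool, (∀ i, i ∉ S → p i = q i) → p ∈ C := by
  obtain ⟨x, hx, hxS⟩ := hA.exists_mem_flat hS
  refine ⟨signVec a b x, fun p hp => ?_⟩
  obtain ⟨v, hv⟩ := exists_dotR_eq (hA.1 S hS) (fun i => if p i then 1 else -1)
  have hev : ∀ᶠ t : ℝ in nhdsWithin 0 (Set.Ioi 0), ∀ i,
      dotR (a i) (x + t • v) ≠ b i ∧ (b i < dotR (a i) (x + t • v) ↔ p i = true) := by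
    rw [Filter.eventually_all]
    intro i
    by_cases hi : i ∈ S
    · filter_upwards [self_mem_nhdsWithin] with t (ht : 0 < t)
      rw [dotR_add_smul, hx i hi, hv i hi]
      cases p i
      · simp [ht.ne', ht.le]
      · simp [ht.ne', ht]
    · filter_upwards [eventually_dotR_ne (hxS i hi) v] with t ht
      refine ⟨ht.1, ht.2.trans ?_⟩
      simp [hp i hi, signVec]
  obtain ⟨t, ht⟩ := hev.exists
  refine (hC p).2 ⟨x + t • v, fun i => (ht i).1, funext fun i => ?_⟩
  rw [Bool.eq_iff_iff]
  simpa [signVec] using (ht i).2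

/-- The class induced by hyperplanes in `ℝ^d` shatters at most `d` coordinates. -/
theorem IsInducedClass.card_le_of_shatters {d n : ℕ} {a : Fin n → Fin d → ℝ} {b : Fin n → ℝ}
    {C : Finset (Fin n → Bool)} (hC : IsInducedClass a b C) {Y : Finset (Fin n)}
    (hY : Shatters C Y) : Y.card ≤ d := by
  by_contra! hcard
  have hdep : ¬ LinearIndependent ℝ (fun i : Y => a i.1) := by
    intro h
    have := h.fintype_card_le_finrank
    simp only [Fintype.card_coe, Module.finrank_fintype_fun_eq_card, Fintype.card_fin] at this
    omega
  rw [Fintype.not_linearIndependent_iff] at hdep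
  obtain ⟨g, hg, k, hk⟩ := hdep
  have hsum : ∀ x : Fin d → ℝ, ∑ i : Y, g i * dotR (a i.1) x = 0 := by
    intro x
    have hcoord : ∀ j, ∑ i : Y, g i * a i.1 j = 0 := fun j => by
      simpa using congrFun hg j
    simp only [dotR, mul_sum]
    rw [sum_comm]
    refine sum_eq_zero fun j _ => ?_
    simp only [← mul_assoc, ← sum_mul, hcoord, zero_mul]
  have hpos : ∀ s : ℝ, s ≠ 0 → 0 < s * -∑ i : Y, g i * b i.1 := by
    intro s hs
    obtain ⟨c, hcC, hc⟩ := hY fun i => if h : i ∈ Y then decide (0 < s * g ⟨i, h⟩) else true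
    obtain ⟨x, hxne, rfl⟩ := (hC c).1 hcC
    have hterm : ∀ i : Y, g i ≠ 0 → 0 < s * g i * (dotR (a i.1) x - b i.1) := by
      intro i hgi
      have hi := hc i.1 i.2
      simp only [signVec, i.2, dite_true, decide_eq_decide] at hi
      rcases lt_or_gt_of_ne (mul_ne_zero hs hgi) with h | h
      · exact mul_pos_of_neg_of_neg h
          (sub_neg.2 ((hxne i.1).lt_of_le (not_lt.1 (mt hi.1 h.not_gt))))
      · exact mul_pos h (sub_pos.2 (hi.2 h))
    have htotal : 0 < ∑ i : Y, s * g i * (dotR (a i.1) x - b i.1) := by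
      refine sum_pos' (fun i _ => ?_) ⟨k, mem_univ k, hterm k hk⟩
      by_cases hgi : g i = 0
      · simp [hgi]
      · exact (hterm i hgi).le
    simpa only [mul_assoc, mul_sub, ← mul_sum, sum_sub_distrib, hsum, mul_zero, zero_sub,
      mul_neg] using htotal
  have h1 := hpos 1 one_ne_zero
  have h2 := hpos (-1) (by norm_num)
  linarith

/-- The concept class induced by a simple linear arrangement of `n`
hyperplanes in `ℝ^d` (`n ≥ d ≥ 1`) is `d`-maximum. -/
theorem stmt6 (d n : ℕ) (hd : 1 ≤ d) (hdn : d ≤ n)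
    (a : Fin n → Fin d → ℝ) (b : Fin n → ℝ) (hA : SimpleArrangement d a b)
    (C : Finset (Fin n → Bool)) (hC : IsInducedClass a b C) :
    IsMaximum C d := by
  have hshat : ∀ Y : Finset (Fin n), Shatters C Y → Y.card ≤ d :=
    fun Y hY => hC.card_le_of_shatters hY
  refine ⟨⟨?_, hshat⟩, card_eq_sum_choose (hA.exists_cube hC) hshat⟩
  obtain ⟨Y, -, hY⟩ := exists_subset_card_eq
    (show d ≤ (univ : Finset (Fin n)).card by simpa using hdn)
  obtain ⟨q, hq⟩ := hA.exists_cube hC Y hY.le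
  refine ⟨Y, hY, fun p => ⟨fun i => if i ∈ Y then p i else q i, hq _ ?_, ?_⟩⟩
  · intro i hi
    simp [hi]
  · intro i hi
    simp [hi]

end GeomCompress
end
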